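/- arXiv:2004.08093 — 8 statements merged into one kernel-verified Lean document; each statement's English description precedes it below -/
import Mathlib

section
/- Let G be a connected graph on n vertices and let v be a vertex of G with degree at least 3. Suppose P = u v_1 v_2 ... v_{x-1} v is a pendant path attached at v (so u has degree 1, the vertices u, v_1, ..., v_{x-1} have degree at most 2, the consecutive vertices of P are adjacent, and the distance from u to v is x), and suppose x < n/2. Then Tr(v_{x-1}) - Tr(v) = n - 2x. -/
/-- The transmission of a vertex `v`: the sum of distances from `v` to all vertices. -/
noncomputable def transmission {V : Type*} [Fintype V] (G : SimpleGraph V) (v : V) : ℕ :=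
  ∑ u, G.dist v u

namespace SimpleGraph

variable {V : Type*} {G : SimpleGraph V}

/-- Along a sequence of consecutively adjacent vertices, distance is at most the index gap. -/
theorem Connected.dist_le_of_adj_succ (hconn : G.Connected) {x : ℕ} {p : Fin (x + 1) → V}
    (hadj : ∀ i : Fin x, G.Adj (p i.castSucc) (p i.succ)) (i j : ℕ) (hij : i + j ≤ x) :
    G.dist (p ⟨i, by omega⟩) (p ⟨i + j, by omega⟩) ≤ j := by
  induction j with
  | zero => simp
  | succ j ih =>
    have h₁ := ih (by omega)
    have h₂ : G.dist (p ⟨i + j, by omega⟩) (p ⟨i + (j + 1), by omega⟩) = 1 :=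
      dist_eq_one_iff_adj.2 (hadj ⟨i + j, by omega⟩)
    have h₃ := hconn.dist_triangle (u := p ⟨i, by omega⟩) (v := p ⟨i + j, by omega⟩)
      (w := p ⟨i + (j + 1), by omega⟩)
    omega

/-- A neighbor of a non-final vertex of a pendant path is a vertex of the path, at most one step
further along. -/
theorem exists_eq_of_adj_pendant_path [Fintype V] [DecidableRel G.Adj] {x : ℕ}
    {p : Fin (x + 1) → V} (hinj : Function.Injective p)
    (hadj : ∀ i : Fin x, G.Adj (p i.castSucc) (p i.succ)) (hdeg1 : G.degree (p 0) = 1)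
    (hdeg2 : ∀ i : Fin (x + 1), i ≠ Fin.last x → G.degree (p i) ≤ 2)
    (i : Fin x) {b : V} (hb : G.Adj (p i.castSucc) b) :
    ∃ j : Fin (x + 1), b = p j ∧ (j : ℕ) ≤ i + 1 := by
  classical
  by_contra! hne
  have hsucc : b ≠ p i.succ := fun h => by simpa using hne _ h
  obtain ⟨k, hk⟩ := i
  cases k with
  | zero =>
    have hsub : ({b, p (Fin.succ ⟨0, hk⟩)} : Finset V) ⊆ G.neighborFinset (p 0) := by
      intro y hy
      rw [mem_neighborFinset]
      rcases Finset.mem_insert.1 hy with rfl | hy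
      · exact hb
      · rw [Finset.mem_singleton.1 hy]
        exact hadj ⟨0, hk⟩
    have := Finset.card_le_card hsub
    rw [Finset.card_pair hsucc, card_neighborFinset_eq_degree] at this
    omega
  | succ k =>
    have hpred : b ≠ p ⟨k, by omega⟩ := fun h => by
      have := hne _ h
      simp only at this
      omega
    have hdiff : p (Fin.succ ⟨k + 1, hk⟩) ≠ p ⟨k, by omega⟩ := fun h => by
      have := congrArg Fin.val (hinj h)
      simp at this
      omega
    have hsub : ({b, p (Fin.succ ⟨k + 1, hk⟩), p ⟨k, by omega⟩} : Finset V) ⊆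
        G.neighborFinset (p (Fin.castSucc ⟨k + 1, hk⟩)) := by
      intro y hy
      rw [mem_neighborFinset]
      simp only [Finset.mem_insert, Finset.mem_singleton] at hy
      rcases hy with rfl | rfl | rfl
      · exact hb
      · exact hadj ⟨k + 1, hk⟩
      · exact (hadj ⟨k, by omega⟩).symm
    have := Finset.card_le_card hsub
    rw [Finset.card_eq_three.2 ⟨_, _, _, hsucc, hpred, hdiff, rfl⟩,
      card_neighborFinset_eq_degree] at this
    have := hdeg2 (Fin.castSucc ⟨k + 1, hk⟩) (Fin.castSucc_lt_last _).ne
    omega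

/-- A walk from a vertex of a pendant path to a vertex off the path passes the attachment vertex. -/
theorem Walk.dist_add_le_length_of_pendant_path {x : ℕ} {p : Fin (x + 1) → V}
    (hnbr : ∀ (i : Fin x) {b : V}, G.Adj (p i.castSucc) b →
      ∃ j : Fin (x + 1), b = p j ∧ (j : ℕ) ≤ i + 1)
    {a w : V} (hw : ∀ i : Fin x, w ≠ p i.castSucc) (q : G.Walk a w) (i : Fin (x + 1))
    (ha : a = p i) : G.dist (p (Fin.last x)) w + (x - i) ≤ q.length := by
  induction q generalizing i with
  | nil =>
    induction i using Fin.lastCases with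
    | last => simp [ha]
    | cast i => exact absurd ha (hw i)
  | cons h q ih =>
    induction i using Fin.lastCases with
    | last =>
      subst ha
      simpa using dist_le (Walk.cons h q)
    | cast i =>
      subst ha
      obtain ⟨j, hj, hji⟩ := hnbr i h
      have := ih hw j hj
      simp only [Walk.length_cons, Fin.val_castSucc]
      omega

end SimpleGraph

/-- Let `G` be a connected graph on `n` vertices and `v` a vertex of degree at least `3`.
If `P = u v₁ v₂ ⋯ v_{x-1} v` is a pendant path attached at `v` (so `u` has degree `1`,
the vertices `u, v₁, …, v_{x-1}` have degree at most `2`, consecutive vertices are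
adjacent, and `d(u,v) = x`), and `x < n/2`, then `Tr(v_{x-1}) - Tr(v) = n - 2x`. -/
theorem stmt_2 {V : Type*} [Fintype V] (G : SimpleGraph V) [DecidableRel G.Adj]
    (hconn : G.Connected) (v : V) (hdegv : 3 ≤ G.degree v)
    (x : ℕ) (hx : 1 ≤ x) (p : Fin (x + 1) → V)
    (hinj : Function.Injective p)
    (hlast : p (Fin.last x) = v)
    (hadj : ∀ i : Fin x, G.Adj (p i.castSucc) (p i.succ))
    (hdeg1 : G.degree (p 0) = 1)
    (hdeg2 : ∀ i : Fin (x + 1), i ≠ Fin.last x → G.degree (p i) ≤ 2)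
    (hdist : G.dist (p 0) v = x)
    (hhalf : 2 * x < Fintype.card V) :
    (transmission G (p ⟨x - 1, by omega⟩) : ℤ) - transmission G v
      = (Fintype.card V : ℤ) - 2 * x := by
  classical
  subst hlast
  have hx' : x - 1 < x := by omega
  set a := p ⟨x - 1, by omega⟩ with ha
  have hav : G.dist a (p (Fin.last x)) = 1 := by
    have hsucc : Fin.last x = Fin.succ ⟨x - 1, hx'⟩ := Fin.ext (Nat.sub_add_cancel hx).symm
    rw [SimpleGraph.dist_eq_one_iff_adj, hsucc]
    exact hadj ⟨x - 1, hx'⟩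
  let S : Finset V := Finset.univ.image fun i : Fin x => p i.castSucc
  have hS : S.card = x := by
    have h := Finset.card_image_of_injective Finset.univ (hinj.comp (Fin.castSucc_injective x))
    rwa [Finset.card_univ, Fintype.card_fin] at h
  have hdiff (w : V) :
      (G.dist a w : ℤ) - G.dist (p (Fin.last x)) w = 1 - 2 * (if w ∈ S then 1 else 0) := by
    split_ifs with hwS
    · obtain ⟨i, -, rfl⟩ := Finset.mem_image.1 hwS
      obtain ⟨i, hi⟩ := i
      have h₁ := hconn.dist_le_of_adj_succ hadj 0 i (by omega)
      have h₂ := hconn.dist_le_of_adj_succ hadj i (x - 1 - i) (by omega)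
      simp only [show i + (x - 1 - i) = x - 1 by omega, ← ha] at h₂
      simp only [zero_add] at h₁
      change G.dist (p 0) _ ≤ i at h₁
      have h₃ := hconn.dist_triangle (u := p 0) (v := p ⟨i, by omega⟩) (w := p (Fin.last x))
      have h₄ := hconn.dist_triangle (u := p ⟨i, by omega⟩) (v := a) (w := p (Fin.last x))
      rw [G.dist_comm (u := a), G.dist_comm (u := p (Fin.last x))]
      simp only [Fin.castSucc_mk]
      omega
    · have hw (i : Fin x) : w ≠ p i.castSucc := fun h =>
        hwS (Finset.mem_image.2 ⟨i, Finset.mem_univ _, h.symm⟩)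
      obtain ⟨q, hq⟩ := hconn.exists_walk_length_eq_dist a w
      have h₁ := q.dist_add_le_length_of_pendant_path
        (SimpleGraph.exists_eq_of_adj_pendant_path hinj hadj hdeg1 hdeg2) hw ⟨x - 1, by omega⟩ ha
      have h₂ := hconn.dist_triangle (u := a) (v := p (Fin.last x)) (w := w)
      simp only at h₁
      omega
  unfold transmission
  push_cast
  rw [← Finset.sum_sub_distrib, Finset.sum_congr rfl fun w _ => hdiff w,
    Finset.sum_sub_distrib, ← Finset.mul_sum]
  simp [hS]
end

section
/- Let t >= 3 and let k_1 <= k_2 <= ... <= k_t be positive integers. If the starlike tree T(k_1, ..., k_t) is transmission irregular, then k_t <= k_1 + k_2 + ... + k_{t-1}. -/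
/-- A graph is transmission irregular if all vertices have pairwise distinct transmissions. -/
def TransmissionIrregular {V : Type*} [Fintype V] (G : SimpleGraph V) : Prop :=
  Function.Injective (transmission G)

/-- The starlike tree `T(k 0, …, k (t-1))`: a central vertex (`none`) with `t` pendant
paths attached, the `i`-th of length `k i`; `some ⟨i, j⟩` is the vertex at distance
`j + 1` from the center on the `i`-th arm. -/
def starlike (t : ℕ) (k : Fin t → ℕ) :
    SimpleGraph (Option (Σ i : Fin t, Fin (k i))) :=
  SimpleGraph.fromRel (fun x y =>
    (∃ i : Fin t, ∃ j : Fin (k i), x = none ∧ y = some ⟨i, j⟩ ∧ (j : ℕ) = 0) ∨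
    (∃ i : Fin t, ∃ j j' : Fin (k i), x = some ⟨i, j⟩ ∧ y = some ⟨i, j'⟩ ∧
      (j' : ℕ) = (j : ℕ) + 1))

/-- A function that vanishes at `v`, changes by at most one along edges, and can be decreased by
one along some edge wherever it is nonzero, away from `v`, is the distance from `v`. -/
theorem SimpleGraph.dist_eq_of_descent {V : Type*} (G : SimpleGraph V) (f : V → ℕ) (v : V)
    (hv : ∀ u, f u = 0 ↔ u = v) (hlip : ∀ x y, G.Adj x y → f y ≤ f x + 1)
    (hdesc : ∀ u, f u ≠ 0 → ∃ w, G.Adj w u ∧ f u = f w + 1) (u : V) :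
    G.dist v u = f u := by
  have hwalk : ∀ n u, f u = n → ∃ p : G.Walk v u, p.length = n := by
    intro n
    induction n with
    | zero =>
      intro u hu
      obtain rfl := (hv u).1 hu
      exact ⟨.nil, rfl⟩
    | succ n ih =>
      intro u hu
      obtain ⟨w, hw, hwu⟩ := hdesc u (by omega)
      obtain ⟨p, hp⟩ := ih w (by omega)
      exact ⟨p.concat hw, by simp [hp]⟩
  have hlen : ∀ {x y : V} (p : G.Walk x y), f y ≤ f x + p.length := by
    intro x y p
    induction p with
    | nil => simp
    | cons h p ih =>
      have := hlip _ _ h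
      rw [SimpleGraph.Walk.length_cons]
      omega
  obtain ⟨p, hp⟩ := hwalk _ u rfl
  obtain ⟨q, hq⟩ := p.reachable.exists_walk_length_eq_dist
  have hqu := hlen q
  rw [(hv v).2 rfl] at hqu
  have := SimpleGraph.dist_le p
  omega

/-- The distance in a starlike tree from the vertex at height `d` on the `i`-th arm
(the center when `d = 0`). -/
def armDist {t : ℕ} {k : Fin t → ℕ} (i : Fin t) (d : ℕ) : Option (Σ i : Fin t, Fin (k i)) → ℕ
  | none => d
  | some ⟨i', j⟩ => if i' = i then (j + 1 - d) + (d - (j + 1)) else j + 1 + d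

theorem starlike_adj_none {t : ℕ} {k : Fin t → ℕ} (i : Fin t) (h : 0 < k i) :
    (starlike t k).Adj none (some ⟨i, ⟨0, h⟩⟩) := by
  rw [starlike, SimpleGraph.fromRel_adj]
  exact ⟨by simp, .inl (.inl ⟨i, ⟨0, h⟩, rfl, rfl, rfl⟩)⟩

theorem starlike_adj_succ {t : ℕ} {k : Fin t → ℕ} (i : Fin t) (j : ℕ) (h : j + 1 < k i) :
    (starlike t k).Adj (some ⟨i, ⟨j, by omega⟩⟩) (some ⟨i, ⟨j + 1, h⟩⟩) := by
  rw [starlike, SimpleGraph.fromRel_adj]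
  exact ⟨by simp, .inl (.inr ⟨i, ⟨j, by omega⟩, ⟨j + 1, h⟩, rfl, rfl, rfl⟩)⟩

theorem armDist_le_of_adj {t : ℕ} {k : Fin t → ℕ} (i : Fin t) (d : ℕ)
    (x y : Option (Σ i : Fin t, Fin (k i))) (h : (starlike t k).Adj x y) :
    armDist i d y ≤ armDist i d x + 1 := by
  rw [starlike, SimpleGraph.fromRel_adj] at h
  rcases h.2 with (⟨i', j, rfl, rfl, hj⟩ | ⟨i', j, j', rfl, rfl, hj⟩) |
    (⟨i', j, rfl, rfl, hj⟩ | ⟨i', j, j', rfl, rfl, hj⟩) <;>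
  · simp only [armDist]
    split_ifs <;> omega

theorem exists_adj_armDist_eq_add_one {t : ℕ} {k : Fin t → ℕ} (i : Fin t) (d : ℕ) (hd : d ≤ k i)
    (u : Option (Σ i : Fin t, Fin (k i))) (hu : armDist i d u ≠ 0) :
    ∃ w, (starlike t k).Adj w u ∧ armDist i d u = armDist i d w + 1 := by
  rcases u with _ | ⟨i', j, hj⟩
  · simp only [armDist] at hu
    refine ⟨_, (starlike_adj_none i (by omega)).symm, ?_⟩
    simp only [armDist, if_true]
    omega
  · by_cases h : i' = i ∧ j + 1 < d
    · obtain ⟨rfl, hjd⟩ := h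
      refine ⟨_, (starlike_adj_succ i' j (by omega)).symm, ?_⟩
      simp only [armDist, if_true]
      omega
    · rcases j with _ | j
      · refine ⟨_, starlike_adj_none i' hj, ?_⟩
        simp only [armDist] at hu ⊢
        split_ifs at hu ⊢ with hi
        · have : ¬ 0 + 1 < d := fun hlt => h ⟨hi, hlt⟩
          omega
        · omega
      · refine ⟨_, starlike_adj_succ i' j hj, ?_⟩
        simp only [armDist] at hu ⊢
        split_ifs at hu ⊢ with hi
        · have : ¬ j + 1 + 1 < d := fun hlt => h ⟨hi, hlt⟩
          omega
        · omega

theorem starlike_dist_none {t : ℕ} {k : Fin t → ℕ} (i : Fin t)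
    (u : Option (Σ i : Fin t, Fin (k i))) :
    (starlike t k).dist none u = armDist i 0 u := by
  refine SimpleGraph.dist_eq_of_descent _ _ _ (fun u => ?_) (armDist_le_of_adj i 0)
    (exists_adj_armDist_eq_add_one i 0 (Nat.zero_le _)) u
  rcases u with _ | ⟨i', j⟩ <;> simp [armDist]

theorem starlike_dist_some {t : ℕ} {k : Fin t → ℕ} (i : Fin t) (d : Fin (k i))
    (u : Option (Σ i : Fin t, Fin (k i))) :
    (starlike t k).dist (some ⟨i, d⟩) u = armDist i (d + 1) u := by
  refine SimpleGraph.dist_eq_of_descent _ _ _ (fun u => ?_) (armDist_le_of_adj i (d + 1))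
    (exists_adj_armDist_eq_add_one i (d + 1) d.isLt) u
  rcases u with _ | ⟨i', j⟩
  · simp [armDist]
  · by_cases hi : i' = i
    · subst hi
      simp only [armDist, if_true, Option.some.injEq, Sigma.mk.injEq, heq_eq_eq, true_and,
        Fin.ext_iff]
      omega
    · simp [armDist, hi]

theorem sum_armDist {t : ℕ} {k : Fin t → ℕ} (i : Fin t) (d : ℕ) :
    ∑ u : Option (Σ i : Fin t, Fin (k i)), armDist i d u =
      d + ∑ j ∈ Finset.range (k i), ((j + 1 - d) + (d - (j + 1))) +
        (∑ i' ∈ Finset.univ.erase i, ∑ j ∈ Finset.range (k i'), (j + 1) +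
          (∑ i' ∈ Finset.univ.erase i, k i') * d) := by
  rw [Fintype.sum_option, Fintype.sum_sigma, ← Finset.add_sum_erase _ _ (Finset.mem_univ i),
    ← add_assoc, Finset.sum_mul, ← Finset.sum_add_distrib]
  congr 1
  · simp only [armDist, if_true]
    rw [Fin.sum_univ_eq_sum_range (fun j => (j + 1 - d) + (d - (j + 1)))]
  · refine Finset.sum_congr rfl fun i' hi' => ?_
    simp only [armDist, if_neg (Finset.ne_of_mem_erase hi')]
    rw [Fin.sum_univ_eq_sum_range (fun j => j + 1 + d), Finset.sum_add_distrib]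
    simp

theorem sum_range_absDiff_add (s d : ℕ) :
    d + ∑ j ∈ Finset.range (d + s), ((j + 1 - d) + (d - (j + 1))) + s * d =
      ∑ j ∈ Finset.range (d + s), (j + 1) := by
  induction s with
  | zero =>
    have h : ∑ j ∈ Finset.range d, ((j + 1 - d) + (d - (j + 1))) = ∑ j ∈ Finset.range d, j := by
      rw [← Finset.sum_range_reflect]
      refine Finset.sum_congr rfl fun j hj => ?_
      have := Finset.mem_range.1 hj
      omega
    rw [add_zero, h, Finset.sum_add_distrib]
    simp [add_comm]
  | succ s ih =>
    rw [← add_assoc, Finset.sum_range_succ, Finset.sum_range_succ, ← ih, add_mul]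
    omega

/-- If the starlike tree `T(k₁, …, k_t)` (with `t ≥ 3` and `k₁ ≤ ⋯ ≤ k_t` positive) is
transmission irregular, then `k_t ≤ k₁ + ⋯ + k_{t-1}`. -/
theorem stmt_3 (t : ℕ) (ht : 3 ≤ t) (k : Fin t → ℕ)
    (hpos : ∀ i, 1 ≤ k i) (hmono : Monotone k)
    (hTI : TransmissionIrregular (starlike t k)) :
    k ⟨t - 1, by omega⟩ ≤ ∑ i ∈ Finset.univ.erase ⟨t - 1, by omega⟩, k i := by
  generalize (⟨t - 1, by omega⟩ : Fin t) = i
  by_contra! hlt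
  obtain ⟨d, hd⟩ := Nat.exists_eq_add_of_lt hlt
  have hdk : d < k i := by omega
  have h : transmission (starlike t k) none = transmission (starlike t k) (some ⟨i, ⟨d, hdk⟩⟩) := by
    simp only [transmission, starlike_dist_none i, starlike_dist_some, sum_armDist]
    have key := sum_range_absDiff_add (∑ i' ∈ Finset.univ.erase i, k i') (d + 1)
    rw [show d + 1 + ∑ i' ∈ Finset.univ.erase i, k i' = k i by omega] at key
    simp only [Nat.sub_zero, Nat.zero_sub, add_zero, zero_add, mul_zero]
    omega
  exact absurd (hTI h) (by simp)
end

section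
/- Let a >= 1 and k >= 2 be integers and let T be the starlike tree T(a, a+1, ..., a+k) with arms of the k+1 consecutive lengths a, a+1, ..., a+k. If the number of vertices of T, namely (k+1)(2a+k)/2 + 1, is odd, then T is transmission irregular. -/
namespace SimpleGraph

/-- A function that grows by at most one along edges and can be decreased by one along some edge
as long as it is positive is the distance to its unique zero. -/
theorem dist_eq_of_forall_adj {V : Type*} (G : SimpleGraph V) (x : V) (f : V → ℕ)
    (hx : f x = 0) (hzero : ∀ y, f y = 0 → y = x)
    (hadj : ∀ u v, G.Adj u v → f v ≤ f u + 1)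
    (hstep : ∀ y, f y ≠ 0 → ∃ z, G.Adj z y ∧ f z + 1 = f y) (y : V) :
    G.dist x y = f y := by
  have hwalk : ∀ u v (p : G.Walk u v), f v ≤ f u + p.length := by
    intro u v p
    induction p with
    | nil => simp
    | cons h p ih =>
      have := hadj _ _ h
      rw [Walk.length_cons]
      omega
  have hex : ∀ n y, f y = n → ∃ p : G.Walk x y, p.length = n := by
    intro n
    induction n with
    | zero =>
      intro y hy
      obtain rfl := hzero y hy
      exact ⟨Walk.nil, rfl⟩
    | succ n ih =>
      intro y hy
      obtain ⟨z, hz, hfz⟩ := hstep y (by omega)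
      obtain ⟨p, hp⟩ := ih z (by omega)
      exact ⟨p.concat hz, by rw [Walk.length_concat, hp]⟩
  obtain ⟨p, hp⟩ := hex _ y rfl
  obtain ⟨q, hq⟩ := p.reachable.exists_walk_length_eq_dist
  have h1 := dist_le p
  have h2 := hwalk _ _ q
  omega

end SimpleGraph

section Starlike

variable {t : ℕ} {k : Fin t → ℕ}

/-- The explicit distance between two vertices of a starlike tree. -/
def starlikeDist : Option (Σ i : Fin t, Fin (k i)) → Option (Σ i : Fin t, Fin (k i)) → ℕ
  | none, none => 0
  | none, some v => v.2 + 1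
  | some u, none => u.2 + 1
  | some u, some v =>
    if u.1 = v.1 then (u.2 - v.2 : ℕ) + (v.2 - u.2 : ℕ) else u.2 + v.2 + 2

theorem starlike_adj_none_some (i : Fin t) (j : Fin (k i)) :
    (starlike t k).Adj none (some ⟨i, j⟩) ↔ (j : ℕ) = 0 := by
  simp only [starlike, SimpleGraph.fromRel_adj]
  constructor
  · rintro ⟨-, (⟨i', j', -, h, h0⟩ | ⟨i', j', j'', h, -⟩) | (⟨i', j', h, -⟩ | ⟨i', j', j'', -, h, -⟩)⟩
    · cases h
      exact h0
    all_goals cases h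
  · intro h
    exact ⟨by simp, Or.inl (Or.inl ⟨i, j, trivial, rfl, h⟩)⟩

theorem starlike_adj_some_some (i i' : Fin t) (j : Fin (k i)) (j' : Fin (k i')) :
    (starlike t k).Adj (some ⟨i, j⟩) (some ⟨i', j'⟩) ↔
      i = i' ∧ ((j' : ℕ) = j + 1 ∨ (j : ℕ) = j' + 1) := by
  simp only [starlike, SimpleGraph.fromRel_adj]
  constructor
  · rintro ⟨-, (⟨_, _, h, -⟩ | ⟨_, _, _, h, h', h0⟩) | (⟨_, _, h, -⟩ | ⟨_, _, _, h, h', h0⟩)⟩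
    · cases h
    · cases h
      cases h'
      exact ⟨rfl, Or.inl h0⟩
    · cases h
    · cases h
      cases h'
      exact ⟨rfl, Or.inr h0⟩
  · rintro ⟨rfl, h⟩
    refine ⟨?_, ?_⟩
    · intro he
      cases he
      omega
    · rcases h with h | h
      · exact Or.inl (Or.inr ⟨i, j, j', rfl, rfl, h⟩)
      · exact Or.inr (Or.inr ⟨i, j', j, rfl, rfl, h⟩)

theorem starlike_dist (x y : Option (Σ i : Fin t, Fin (k i))) :
    (starlike t k).dist x y = starlikeDist x y := by
  refine SimpleGraph.dist_eq_of_forall_adj _ x (starlikeDist x) ?_ ?_ ?_ ?_ y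
  · rcases x with _ | ⟨i, j⟩ <;> simp [starlikeDist]
  · rintro (_ | ⟨i', j'⟩) h <;> rcases x with _ | ⟨i, j⟩
    · rfl
    · simp [starlikeDist] at h
    · simp [starlikeDist] at h
    · by_cases hi : i = i'
      · subst hi
        have hj : j' = j := by
          simp only [starlikeDist, if_true] at h
          ext
          omega
        rw [hj]
      · simp [starlikeDist, hi] at h
  · rintro (_ | ⟨i, j⟩) (_ | ⟨i', j'⟩) h
    · exact absurd h (SimpleGraph.irrefl _)
    · rw [starlike_adj_none_some] at h
      rcases x with _ | ⟨l, m⟩ <;> simp only [starlikeDist] <;> (try split_ifs) <;> omega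
    · rw [SimpleGraph.adj_comm, starlike_adj_none_some] at h
      rcases x with _ | ⟨l, m⟩ <;> simp only [starlikeDist] <;> (try split_ifs) <;> omega
    · rw [starlike_adj_some_some] at h
      obtain ⟨rfl, h⟩ := h
      rcases x with _ | ⟨l, m⟩ <;> simp only [starlikeDist] <;> (try split_ifs) <;> omega
  · have hdown : ∀ (i : Fin t) (j : Fin (k i)), ∃ z, (starlike t k).Adj z (some ⟨i, j⟩) ∧
        ((j : ℕ) = 0 ∧ z = none ∨
          ∃ j' : Fin (k i), z = some ⟨i, j'⟩ ∧ (j : ℕ) = j' + 1) := by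
      intro i j
      by_cases hj : (j : ℕ) = 0
      · exact ⟨none, (starlike_adj_none_some i j).2 hj, Or.inl ⟨hj, rfl⟩⟩
      · refine ⟨some ⟨i, ⟨j - 1, by omega⟩⟩, (starlike_adj_some_some _ _ _ _).2
          ⟨rfl, Or.inl ?_⟩, Or.inr ⟨_, rfl, ?_⟩⟩ <;> simp only <;> omega
    rintro (_ | ⟨i', j'⟩) h <;> rcases x with _ | ⟨i, j⟩
    · exact absurd rfl h
    · have hk := j.isLt
      refine ⟨some ⟨i, ⟨0, by omega⟩⟩, ?_, ?_⟩
      · rw [SimpleGraph.adj_comm, starlike_adj_none_some]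
      · simp [starlikeDist]
    · obtain ⟨z, hz, ⟨h0, rfl⟩ | ⟨m, rfl, hm⟩⟩ := hdown i' j'
      · exact ⟨_, hz, by simp [starlikeDist, h0]⟩
      · exact ⟨_, hz, by simp only [starlikeDist]; omega⟩
    · by_cases hi : i = i'
      · subst hi
        by_cases hlt : (j' : ℕ) < j
        · refine ⟨some ⟨i, ⟨j' + 1, by omega⟩⟩, ?_, ?_⟩
          · rw [starlike_adj_some_some]
            exact ⟨rfl, Or.inr rfl⟩
          · simp only [starlikeDist, if_true]
            omega
        · simp only [starlikeDist, if_true] at h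
          obtain ⟨z, hz, ⟨h0, rfl⟩ | ⟨m, rfl, hm⟩⟩ := hdown i j'
          · omega
          · exact ⟨_, hz, by simp only [starlikeDist, if_true]; omega⟩
      · obtain ⟨z, hz, ⟨h0, rfl⟩ | ⟨m, rfl, hm⟩⟩ := hdown i' j'
        · exact ⟨_, hz, by simp only [starlikeDist, if_neg hi]; omega⟩
        · exact ⟨_, hz, by simp only [starlikeDist, if_neg hi]; omega⟩

theorem sum_range_natDist (j n : ℕ) (hj : j < n) :
    ∑ m ∈ Finset.range n, (((j - m : ℕ) + (m - j : ℕ) : ℕ) : ℤ) =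
      ∑ m ∈ Finset.range n, ((m : ℤ) + 1) + (j + 1) * (j - 2 * n) + (j + 1) * n := by
  have hself : ∀ r : ℕ, r ≤ j + 1 →
      ∑ m ∈ Finset.range r, (((j - m : ℕ) + (m - j : ℕ) : ℕ) : ℤ) =
        ∑ m ∈ Finset.range r, ((m : ℤ) + 1) + r * (j - r) := by
    intro r
    induction r with
    | zero => simp
    | succ r ih =>
      intro hr
      have h : (((j - r : ℕ) + (r - j : ℕ) : ℕ) : ℤ) = j - r := by omega
      rw [Finset.sum_range_succ, Finset.sum_range_succ, ih (by omega), h]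
      push_cast
      ring
  induction n, hj using Nat.le_induction with
  | base =>
    rw [hself _ le_rfl]
    push_cast
    ring
  | succ n hn ih =>
    have h : (((j - n : ℕ) + (n - j : ℕ) : ℕ) : ℤ) = n - j := by omega
    rw [Finset.sum_range_succ, Finset.sum_range_succ, ih, h]
    push_cast
    ring

theorem transmission_starlike_some (i : Fin t) (j : Fin (k i)) :
    (transmission (starlike t k) (some ⟨i, j⟩) : ℤ) =
      transmission (starlike t k) none +
        ((j : ℤ) + 1) * (∑ l, (k l : ℤ) - 2 * k i + (j + 1)) := by
  have harm : ∀ l : Fin t, ∑ m : Fin (k l), (starlikeDist (some ⟨i, j⟩) (some ⟨l, m⟩) : ℤ) =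
      ∑ m : Fin (k l), ((m : ℤ) + 1) + ((j : ℤ) + 1) * k l +
        if i = l then ((j : ℤ) + 1) * (j - 2 * k i) else 0 := by
    intro l
    by_cases hl : i = l
    · subst hl
      simp only [starlikeDist, if_true]
      rw [Fin.sum_univ_eq_sum_range (fun m => (((j - m : ℕ) + (m - j : ℕ) : ℕ) : ℤ)),
        Fin.sum_univ_eq_sum_range (fun m => ((m : ℤ) + 1)), sum_range_natDist _ _ j.isLt]
      ring
    · simp only [starlikeDist, if_neg hl, add_zero]
      have : ∀ m : Fin (k l), (((j : ℕ) + m + 2 : ℕ) : ℤ) = ((m : ℤ) + 1) + (j + 1) := by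
        intro m
        push_cast
        ring
      simp only [this]
      rw [Finset.sum_add_distrib, Finset.sum_const, Finset.card_univ, Fintype.card_fin,
        nsmul_eq_mul]
      ring
  simp only [transmission, starlike_dist, Fintype.sum_option, Fintype.sum_sigma, Nat.cast_add,
    Nat.cast_sum, harm, Finset.sum_add_distrib, ← Finset.mul_sum, Finset.sum_ite_eq,
    Finset.mem_univ, if_true]
  simp only [starlikeDist, Nat.cast_add, Nat.cast_one, Nat.cast_zero, Finset.sum_add_distrib]
  ring

end Starlike

theorem two_mul_sum_arith (a k : ℕ) :
    2 * ∑ l : Fin (k + 1), ((a + l.val : ℕ) : ℤ) = (k + 1) * (2 * a + k) := by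
  rw [Fin.sum_univ_eq_sum_range (fun l => ((a + l : ℕ) : ℤ))]
  induction k with
  | zero => simp
  | succ k ih =>
    rw [Finset.sum_range_succ, mul_add, ih]
    push_cast
    ring

/-- Vertices at depths `d` and `d'` on arms of different lengths `a + i' < a + i` have different
transmissions. -/
theorem depth_mul_ne {a k i i' d d' s : ℤ} (ha : 1 ≤ a) (hk : 2 ≤ k)
    (hs : 4 * s = (k + 1) * (2 * a + k)) (hi' : 0 ≤ i') (hlt : i' < i) (hi : i ≤ k)
    (hd : 1 ≤ d) (hd' : 1 ≤ d') (hda' : d' ≤ a + i') :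
    d * (2 * s - 2 * (a + i) + d) ≠ d' * (2 * s - 2 * (a + i') + d') := by
  intro h
  obtain ⟨M, rfl⟩ : ∃ M, s = M + (a + i) := ⟨s - (a + i), by ring⟩
  obtain ⟨δ, rfl⟩ : ∃ δ, i = i' + δ := ⟨i - i', by ring⟩
  have hM : 0 ≤ M := by nlinarith
  have h1 : d * (2 * M + d) = d' * (2 * M + 2 * δ + d') := by linear_combination h
  have hdd : d' < d := by
    by_contra! hc
    nlinarith
  obtain ⟨e, he⟩ : ∃ e, d = d' + 2 * e := by
    have hpar : Even (d * d - d' * d') := ⟨d' * (M + δ) - d * M, by linear_combination h1⟩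
    have : Even (d - d') := by
      rw [Int.even_sub, Int.even_mul, Int.even_mul, or_self, or_self] at hpar
      exact Int.even_sub.2 hpar
    obtain ⟨e, he⟩ := this
    exact ⟨e, by linarith⟩
  subst he
  have he : 1 ≤ e := by omega
  have h2 : (δ - 2 * e) * d' = 2 * e * (e + M) := by linarith
  have h3 : 2 * (1 + M) ≤ 2 * e * (e + M) := by nlinarith
  have h4 : (δ - 2 * e) * d' ≤ (δ - 2) * d' := by nlinarith
  have hδ : 0 ≤ δ - 2 := by
    by_contra! hc
    nlinarith
  have h5 : (δ - 2) * d' ≤ (δ - 2) * (a + i') := mul_le_mul_of_nonneg_left hda' hδ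
  have h6 : (δ - 2) * (a + i') ≤ (k - i' - 2) * (a + i') :=
    mul_le_mul_of_nonneg_right (by linarith) (by linarith)
  nlinarith [sq_nonneg i', sq_nonneg (2 * (k - i') - 3), mul_nonneg hi' (sub_nonneg.2 ha)]

/-- If the unit arithmetic starlike tree `T(a, a+1, …, a+k)` (`k ≥ 2`) has odd order
`(k+1)(2a+k)/2 + 1`, then it is transmission irregular. -/
theorem stmt_4 (a k : ℕ) (ha : 1 ≤ a) (hk : 2 ≤ k)
    (hodd : Odd ((k + 1) * (2 * a + k) / 2 + 1)) :
    TransmissionIrregular (starlike (k + 1) (fun i => a + i.val)) := by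
  have hsum := two_mul_sum_arith a k
  obtain ⟨s, hs⟩ : ∃ s : ℤ, ∑ l : Fin (k + 1), ((a + l.val : ℕ) : ℤ) = 2 * s := by
    obtain ⟨r, hr⟩ := hodd
    refine ⟨r, ?_⟩
    have : (((k + 1) * (2 * a + k) : ℕ) : ℤ) = (k + 1) * (2 * a + k) := by push_cast; ring
    omega
  rw [hs] at hsum
  have h4 : 4 * s = ((k : ℤ) + 1) * (2 * a + k) := by linarith
  have haZ : (1 : ℤ) ≤ a := by exact_mod_cast ha
  have hkZ : (2 : ℤ) ≤ k := by exact_mod_cast hk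
  have hnonneg : ∀ i : Fin (k + 1), 0 ≤ 2 * s - 2 * ((a : ℤ) + i.val) := by
    intro i
    have : (i.val : ℤ) ≤ k := by exact_mod_cast Nat.lt_succ_iff.1 i.isLt
    nlinarith
  have hpos : ∀ (i : Fin (k + 1)) (j : Fin (a + i.val)),
      0 < ((j : ℤ) + 1) * (2 * s - 2 * ((a : ℤ) + i.val) + (j + 1)) := by
    intro i j
    have := hnonneg i
    have : (0 : ℤ) ≤ (j : ℕ) := by positivity
    apply mul_pos <;> linarith
  have htr : ∀ (i : Fin (k + 1)) (j : Fin (a + i.val)),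
      (transmission (starlike (k + 1) (fun i => a + i.val)) (some ⟨i, j⟩) : ℤ) =
        transmission (starlike (k + 1) (fun i => a + i.val)) none +
          ((j : ℤ) + 1) * (2 * s - 2 * ((a : ℤ) + i.val) + (j + 1)) := by
    intro i j
    rw [transmission_starlike_some, hs]
    push_cast
    ring
  have hne : ∀ (i i' : Fin (k + 1)) (j : Fin (a + i.val)) (j' : Fin (a + i'.val)), i' < i →
      ((j : ℤ) + 1) * (2 * s - 2 * ((a : ℤ) + i.val) + (j + 1)) ≠
        ((j' : ℤ) + 1) * (2 * s - 2 * ((a : ℤ) + i'.val) + (j' + 1)) := by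
    intro i i' j j' hlt
    have := i.isLt
    have := j'.isLt
    have : i'.val < i.val := hlt
    apply depth_mul_ne haZ hkZ h4 <;> omega
  rintro (_ | ⟨i, j⟩) (_ | ⟨i', j'⟩) h
  · rfl
  · have := htr i' j'
    have := hpos i' j'
    rw [h] at *
    linarith
  · have := htr i j
    have := hpos i j
    rw [h] at *
    linarith
  · have e1 := htr i j
    have e2 := htr i' j'
    rw [h, e2] at e1
    have e3 := add_left_cancel e1
    rcases lt_trichotomy i i' with hlt | rfl | hlt
    · exact absurd e3 (hne i' i j' j hlt)
    · have hj : (j : ℤ) = (j' : ℕ) := by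
        have := hnonneg i
        have : (0 : ℤ) ≤ (j : ℕ) := by positivity
        have : (0 : ℤ) ≤ (j' : ℕ) := by positivity
        rcases lt_trichotomy (j : ℤ) (j' : ℕ) with hc | hc | hc
        · nlinarith
        · exact hc
        · nlinarith
      have : j = j' := Fin.ext (by exact_mod_cast hj)
      rw [this]
    · exact absurd e3.symm (hne i i' j j' hlt)
end

section
/- Let a >= 1 and k >= 2 be integers such that (k+1)(2a+k)/2 + 1 is odd (equivalently, (k+1)(2a+k) is divisible by 4). Set s = (k-1)(2a+k-2)/2 - 2, and for p in {1, ..., a+k} define B_p = { p*s + p(p-1) + 2*p*i : i in {1, ..., k+1} } if p <= a, and B_p = { p*s + p(p-1) + 2*p*i : i in {1, ..., (k+1)-(p-a)} } if a < p <= a+k. Then the sets B_1, ..., B_{a+k} are pairwise disjoint. -/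
/-- The set `B_p`:
`B_p = {p·s + p(p-1) + 2·p·i : i ∈ [k+1]}` for `p ∈ [a]`, and
`B_p = {p·s + p(p-1) + 2·p·i : i ∈ [(k+1)-(p-a)]}` for `a < p ≤ a+k`. -/
def Bset (a k : ℕ) (s : ℤ) (p : ℕ) : Set ℤ :=
  {x : ℤ | ∃ i : ℕ, 1 ≤ i ∧ i ≤ (if p ≤ a then k + 1 else (k + 1) - (p - a)) ∧
    x = (p : ℤ) * s + (p : ℤ) * ((p : ℤ) - 1) + 2 * (p : ℤ) * (i : ℤ)}

/-- Differences of squares `d ^ 2 - c ^ 2` in the range relevant to `Bset` cannot coincide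
for two different values of `d`. The parity of `d - d'` and `c - c'` agrees, so these
gaps differ by at least two, which is incompatible with the range. -/
lemma not_lt_of_sq_sub_sq_eq {a k N c d c' d' : ℤ} (ha : 1 ≤ a)
    (hN : 4 * N = (k + 1) * (2 * a + k)) (hd : d ≤ N) (hc : c ≤ N - a)
    (hc' : N - a - k ≤ c') (hcd : c < d) (hcd' : c' < d') (hc0 : 0 ≤ c) (hc0' : 0 ≤ c')
    (h : d ^ 2 - c ^ 2 = d' ^ 2 - c' ^ 2) : ¬ d' < d := by
  intro hlt
  have hprod : (d - d') * (d + d') = (c - c') * (c + c') := by linarith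
  have hgap : d - d' < c - c' := by nlinarith
  have hpar : Even ((c - c') - (d - d')) := by
    have := congrArg Even h
    simp only [Int.even_sub, Int.even_pow] at this ⊢
    grind
  obtain ⟨t, ht⟩ := hpar
  obtain ⟨g, hg⟩ : ∃ g, g = c - c' := ⟨_, rfl⟩
  obtain ⟨e, he⟩ : ∃ e, e = d - d' := ⟨_, rfl⟩
  have hge : g = e + 2 * t := by linarith
  have ht1 : 1 ≤ t := by omega
  have he1 : 1 ≤ e := by omega
  have hgk : g ≤ k := by omega
  have hupper : e * (d + d') ≤ e * (2 * N - e) :=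
    mul_le_mul_of_nonneg_left (by linarith) (by linarith)
  have hlower : g * (2 * N - 2 * a - 2 * k + g) ≤ g * (c + c') :=
    mul_le_mul_of_nonneg_left (by linarith) (by linarith)
  have hmain : t * (4 * N) ≤ 2 * g * (a + k) - g ^ 2 - (g - 2 * t) ^ 2 := by
    rw [← he, ← hg] at hprod
    obtain rfl : e = g - 2 * t := by linarith
    nlinarith
  have hbase : 2 * g * (a + k) - g ^ 2 - (g - 2) ^ 2 < 4 * N := by
    nlinarith [mul_nonneg (by linarith : 0 ≤ a) (sub_nonneg.2 hgk), sq_nonneg (2 * g - k - 2),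
      sq_nonneg (k - 1)]
  have hstep : 0 ≤ (t - 1) * (4 * N - 4 * (g - t - 1)) :=
    mul_nonneg (by linarith) (by nlinarith)
  nlinarith

/-- Every element of `Bset a k (2 * r + 1) p` is a difference of squares `(p + c) ^ 2 - c ^ 2`. -/
lemma exists_sq_sub_sq_of_mem_Bset {a k p : ℕ} {r x : ℤ}
    (hx : x ∈ Bset a k (2 * r + 1) p) :
    ∃ c : ℤ, r + 1 ≤ c ∧ c ≤ r + k + 1 ∧ p + c ≤ r + a + k + 1 ∧
      x = (p + c) ^ 2 - c ^ 2 := by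
  obtain ⟨i, hi, hi', rfl⟩ := hx
  refine ⟨r + i, by omega, ?_, ?_, by ring⟩ <;> split_ifs at hi' <;> omega

/-- If `a ≥ 1`, `k ≥ 2` and `(k+1)(2a+k)/2 + 1` is odd, then with
`s = (k-1)(2a+k-2)/2 - 2` the sets `B_1, …, B_{a+k}` are pairwise disjoint. -/
theorem stmt_6 (a k : ℕ) (ha : 1 ≤ a) (hk : 2 ≤ k)
    (hodd : Odd ((k + 1) * (2 * a + k) / 2 + 1))
    (s : ℤ) (hs : 2 * s = ((k : ℤ) - 1) * (2 * (a : ℤ) + (k : ℤ) - 2) - 4) :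
    ∀ p ∈ Set.Icc 1 (a + k), ∀ q ∈ Set.Icc 1 (a + k), p ≠ q →
      Disjoint (Bset a k s p) (Bset a k s q) := by
  rintro p ⟨hp1, hp⟩ q ⟨hq1, hq⟩ hpq
  obtain ⟨N, hN⟩ : ∃ N : ℕ, 4 * N = (k + 1) * (2 * a + k) := by
    have heven : Even ((k + 1) * (2 * a + k)) := by
      simp only [Nat.even_mul, Nat.even_add, Nat.not_even_one, even_two, true_or, true_iff,
        iff_false]
      tauto
    obtain ⟨m, hm⟩ := hodd
    obtain ⟨n, hn⟩ := heven
    exact ⟨n / 2, by omega⟩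
  have hNz : 4 * (N : ℤ) = (k + 1) * (2 * a + k) := by exact_mod_cast hN
  have haz : (1 : ℤ) ≤ a := by exact_mod_cast ha
  have hkz : (2 : ℤ) ≤ k := by exact_mod_cast hk
  have hlow : (0 : ℤ) ≤ N - a - k := by nlinarith
  obtain rfl : s = 2 * ((N : ℤ) - a - k - 1) + 1 := by linarith
  rw [Set.disjoint_left]
  intro x hx hx'
  obtain ⟨c, hc1, hc2, hc3, hxc⟩ := exists_sq_sub_sq_of_mem_Bset hx
  obtain ⟨b, hb1, hb2, hb3, hxb⟩ := exists_sq_sub_sq_of_mem_Bset hx'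
  have heq := hxc.symm.trans hxb
  have h1 := not_lt_of_sq_sub_sq_eq haz hNz (by linarith) (by linarith) (by linarith)
    (by omega) (by omega) (by linarith) (by linarith) heq
  have h2 := not_lt_of_sq_sub_sq_eq haz hNz (by linarith) (by linarith) (by linarith)
    (by omega) (by omega) (by linarith) (by linarith) heq.symm
  have hd : (p : ℤ) + c = q + b := le_antisymm (not_lt.1 h1) (not_lt.1 h2)
  rw [hd] at heq
  have hcb : c = b := (sq_eq_sq₀ (by linarith) (by linarith)).1 (by linarith)
  omega
end

section
/- Let a >= 1 and k >= 2 be integers and let T be the starlike tree whose arm lengths are a, a+1, ..., a+k-2, a+k, a+k+1 (that is, the consecutive lengths from a to a+k+1 with a+k-1 omitted). If k is congruent to 3 modulo 4, or k + 2a is congruent to 0 modulo 4, then T is transmission irregular. -/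
/-- A function `d` is the graph distance from `u` as soon as it vanishes exactly at `u`, grows by
at most one along edges, and can be lowered by one along an edge wherever it is positive. -/
theorem SimpleGraph.dist_eq_of_lipschitz_of_descent {V : Type*} {G : SimpleGraph V} {u : V}
    {d : V → ℕ} (hd : ∀ v, d v = 0 ↔ v = u) (hlip : ∀ v w, G.Adj v w → d w ≤ d v + 1)
    (hdesc : ∀ v m, d v = m + 1 → ∃ w, G.Adj w v ∧ d w = m) (v : V) : G.dist u v = d v := by
  have hlower : ∀ {x y : V} (p : G.Walk x y), d y ≤ d x + p.length := by
    intro x y p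
    induction p with
    | nil => simp
    | cons h p ih =>
      have := hlip _ _ h
      rw [SimpleGraph.Walk.length_cons]
      omega
  have hupper : ∀ m v, d v = m → ∃ p : G.Walk u v, p.length = m := by
    intro m
    induction m with
    | zero =>
      intro v hv
      obtain rfl := (hd v).1 hv
      exact ⟨.nil, rfl⟩
    | succ m ih =>
      intro v hv
      obtain ⟨w, hw, hdw⟩ := hdesc v m hv
      obtain ⟨p, hp⟩ := ih w hdw
      exact ⟨p.concat hw, by simp [hp]⟩
  obtain ⟨p, hp⟩ := hupper _ v rfl
  obtain ⟨q, hq⟩ := p.reachable.exists_walk_length_eq_dist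
  have h₁ := hlower q
  have h₂ := SimpleGraph.dist_le p
  have h₃ := (hd u).2 rfl
  omega

namespace Starlike

variable {t : ℕ} {k : Fin t → ℕ}

/-- The explicit distance function of a starlike tree. -/
def armDist : Option (Σ i : Fin t, Fin (k i)) → Option (Σ i : Fin t, Fin (k i)) → ℕ
  | none, none => 0
  | none, some y => y.2 + 1
  | some x, none => x.2 + 1
  | some x, some y =>
    if x.1 = y.1 then ((x.2 : ℕ) - y.2) + (y.2 - x.2) else x.2 + y.2 + 2

theorem adj_none_some (i : Fin t) (j : Fin (k i)) :
    (starlike t k).Adj none (some ⟨i, j⟩) ↔ (j : ℕ) = 0 := by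
  simp only [starlike, SimpleGraph.fromRel_adj]
  constructor
  · rintro ⟨-, (⟨i', j', -, h, h0⟩ | ⟨i', j', j'', h, -⟩) |
      (⟨i', j', h, -⟩ | ⟨i', j', j'', -, h, -⟩)⟩
    · cases h; exact h0
    all_goals cases h
  · intro h
    exact ⟨by simp, .inl (.inl ⟨i, j, trivial, rfl, h⟩)⟩

theorem adj_some_some (i i' : Fin t) (j : Fin (k i)) (j' : Fin (k i')) :
    (starlike t k).Adj (some ⟨i, j⟩) (some ⟨i', j'⟩) ↔
      i = i' ∧ ((j' : ℕ) = j + 1 ∨ (j : ℕ) = j' + 1) := by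
  simp only [starlike, SimpleGraph.fromRel_adj]
  constructor
  · rintro ⟨-, (⟨_, _, h, -⟩ | ⟨_, _, _, h, h', e⟩) | (⟨_, _, h, -⟩ | ⟨_, _, _, h, h', e⟩)⟩
    · cases h
    · cases h; cases h'; exact ⟨rfl, .inl e⟩
    · cases h
    · cases h; cases h'; exact ⟨rfl, .inr e⟩
  · rintro ⟨rfl, h⟩
    refine ⟨?_, ?_⟩
    · intro e
      cases e
      omega
    · rcases h with h | h
      · exact .inl (.inr ⟨i, j, j', rfl, rfl, h⟩)
      · exact .inr (.inr ⟨i, j', j, rfl, rfl, h⟩)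

theorem armDist_eq_zero_iff (u v : Option (Σ i : Fin t, Fin (k i))) :
    armDist u v = 0 ↔ v = u := by
  rcases u with _ | ⟨i, j⟩ <;> rcases v with _ | ⟨i', j'⟩
  · simp [armDist]
  · simp [armDist]
  · simp [armDist]
  · by_cases h : i = i'
    · subst h
      simp [armDist, Fin.ext_iff]
      omega
    · simp [armDist, h, Ne.symm h]

theorem armDist_le_of_adj (u v w : Option (Σ i : Fin t, Fin (k i)))
    (h : (starlike t k).Adj v w) : armDist u w ≤ armDist u v + 1 := by
  rcases v with _ | ⟨i, j⟩ <;> rcases w with _ | ⟨i', j'⟩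
  · exact absurd h (SimpleGraph.irrefl _)
  · rw [adj_none_some] at h
    rcases u with _ | ⟨i'', j''⟩ <;> simp only [armDist] <;> (try split_ifs) <;> omega
  · rw [SimpleGraph.adj_comm, adj_none_some] at h
    rcases u with _ | ⟨i'', j''⟩ <;> simp only [armDist] <;> (try split_ifs) <;> omega
  · rw [adj_some_some] at h
    obtain ⟨rfl, h⟩ := h
    rcases u with _ | ⟨i'', j''⟩ <;> simp only [armDist] <;> (try split_ifs) <;> omega

theorem exists_adj_armDist_eq (u v : Option (Σ i : Fin t, Fin (k i))) (m : ℕ)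
    (h : armDist u v = m + 1) : ∃ w, (starlike t k).Adj w v ∧ armDist u w = m := by
  have toward_center : ∀ (i : Fin t) (j : Fin (k i)),
      (j : ℕ) = 0 ∧ (starlike t k).Adj none (some ⟨i, j⟩) ∨
        ∃ j' : Fin (k i), (j : ℕ) = j' + 1 ∧ (starlike t k).Adj (some ⟨i, j'⟩) (some ⟨i, j⟩) := by
    intro i j
    by_cases hj : (j : ℕ) = 0
    · exact .inl ⟨hj, (adj_none_some i j).2 hj⟩
    · have e : (j : ℕ) = (j : ℕ) - 1 + 1 := by omega
      exact .inr ⟨⟨j - 1, by omega⟩, e, (adj_some_some _ _ _ _).2 ⟨rfl, .inl e⟩⟩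
  rcases u with _ | ⟨i, j⟩ <;> rcases v with _ | ⟨i', j'⟩
  · simp [armDist] at h
  · simp only [armDist] at h
    rcases toward_center i' j' with ⟨h0, hadj⟩ | ⟨l, hl, hadj⟩
    · exact ⟨_, hadj, by simp only [armDist]; omega⟩
    · exact ⟨_, hadj, by simp only [armDist]; omega⟩
  · simp only [armDist] at h
    exact ⟨some ⟨i, ⟨0, by omega⟩⟩, ((adj_none_some _ _).2 rfl).symm, by simp [armDist]; omega⟩
  · by_cases hi : i = i'
    · subst hi
      simp only [armDist, if_true] at h
      rcases lt_or_ge (j' : ℕ) j with hlt | hge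
      · exact ⟨some ⟨i, ⟨j' + 1, by omega⟩⟩, (adj_some_some _ _ _ _).2 ⟨rfl, .inr rfl⟩,
          by simp only [armDist, if_true]; omega⟩
      · exact ⟨some ⟨i, ⟨j' - 1, by omega⟩⟩,
          (adj_some_some _ _ _ _).2 ⟨rfl, .inl (by simp only; omega)⟩,
          by simp only [armDist, if_true]; omega⟩
    · simp only [armDist, if_neg hi] at h
      rcases toward_center i' j' with ⟨h0, hadj⟩ | ⟨l, hl, hadj⟩
      · exact ⟨_, hadj, by simp only [armDist]; omega⟩
      · exact ⟨_, hadj, by simp only [armDist, if_neg hi]; omega⟩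

theorem dist_eq_armDist (u v : Option (Σ i : Fin t, Fin (k i))) :
    (starlike t k).dist u v = armDist u v :=
  SimpleGraph.dist_eq_of_lipschitz_of_descent (armDist_eq_zero_iff u)
    (armDist_le_of_adj u) (exists_adj_armDist_eq u) v

/-- Compares the distances along a path of `L` vertices measured from its vertex `j` with
those measured from a vertex attached to its first end. -/
theorem sum_range_dist (L j : ℕ) (hj : j < L) :
    ∑ x ∈ Finset.range L, (((j - x) + (x - j) : ℕ) : ℤ) =
      ∑ x ∈ Finset.range L, ((x : ℤ) + 1) + ((j : ℤ) + 1) * (j - L) := by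
  have before : ∀ m ≤ j, ∑ x ∈ Finset.range m, (((j - x) + (x - j) : ℕ) : ℤ) =
      ∑ x ∈ Finset.range m, ((x : ℤ) + 1) + m * (j - m) := by
    intro m
    induction m with
    | zero => simp
    | succ m ih =>
      intro hm
      rw [Finset.sum_range_succ, Finset.sum_range_succ, ih (by omega),
        show (j - m) + (m - j) = j - m by omega, Nat.cast_sub (by omega)]
      push_cast
      ring
  induction L, hj using Nat.le_induction with
  | base =>
    rw [Finset.sum_range_succ, Finset.sum_range_succ, before j le_rfl]
    push_cast
    simp only [Nat.sub_self]
    ring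
  | succ L hL ih =>
    rw [Finset.sum_range_succ, Finset.sum_range_succ, ih,
      show (j - L) + (L - j) = L - j by omega, Nat.cast_sub (by omega)]
    push_cast
    ring

theorem transmission_none :
    (transmission (starlike t k) none : ℤ) = ∑ i, ∑ j : Fin (k i), ((j : ℤ) + 1) := by
  simp [transmission, dist_eq_armDist, Fintype.sum_option, Fintype.sum_sigma, armDist]

/-- The transmission of the vertex at distance `j + 1` from the center on arm `i`. -/
theorem transmission_some (i : Fin t) (j : Fin (k i)) :
    (transmission (starlike t k) (some ⟨i, j⟩) : ℤ) = transmission (starlike t k) none +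
      ((j : ℤ) + 1) * (1 + ∑ l, (k l : ℤ) - 2 * k i + j) := by
  have harm : ∀ l, ∑ x : Fin (k l), (armDist (some ⟨i, j⟩) (some ⟨l, x⟩) : ℤ) =
      ∑ x : Fin (k l), ((x : ℤ) + 1) + ((j : ℤ) + 1) * k l +
        if l = i then ((j : ℤ) + 1) * (j - 2 * k i) else 0 := by
    intro l
    by_cases hl : l = i
    · subst hl
      have h := sum_range_dist (k l) j j.2
      rw [← Fin.sum_univ_eq_sum_range (fun x => ((((j : ℕ) - x) + (x - j) : ℕ) : ℤ)),
        ← Fin.sum_univ_eq_sum_range (fun x => (x : ℤ) + 1)] at h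
      simp only [armDist, if_true]
      rw [h]
      ring
    · simp only [armDist, if_neg hl, if_neg (Ne.symm hl)]
      have : ∀ x : Fin (k l), (((j : ℕ) + x + 2 : ℕ) : ℤ) = ((x : ℤ) + 1) + (j + 1) := by
        intro x
        push_cast
        ring
      simp only [this, Finset.sum_add_distrib (f := fun x : Fin (k l) => (x : ℤ) + 1)]
      simp
      ring
  rw [transmission_none]
  simp only [transmission, dist_eq_armDist, Fintype.sum_option, Fintype.sum_sigma]
  push_cast
  simp only [harm, Finset.sum_add_distrib, Finset.sum_ite_eq', Finset.mem_univ, if_true,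
    ← Finset.mul_sum]
  simp only [armDist]
  push_cast
  ring

/-- Twice the number of vertices of the tree `T[a, a+k-2; a+k, a+k+1]`. -/
theorem two_mul_one_add_sum_broken_arms (a k : ℕ) (hk : 1 ≤ k) :
    2 * (1 + ∑ l : Fin (k + 1),
      ((if l.val < k - 1 then a + l.val else a + l.val + 1 : ℕ) : ℤ)) =
      (k + 1) * (2 * a + k) + 6 := by
  obtain ⟨m, rfl⟩ : ∃ m, k = m + 1 := ⟨k - 1, by omega⟩
  have hsum : ∀ m : ℕ, 2 * ∑ x ∈ Finset.range m, ((a : ℤ) + x) = m * (2 * a + m - 1) := by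
    intro m
    induction m with
    | zero => simp
    | succ m ih =>
      rw [Finset.sum_range_succ, mul_add, ih]
      push_cast
      ring
  rw [Fin.sum_univ_eq_sum_range
    (fun l => ((if l < m + 1 - 1 then a + l else a + l + 1 : ℕ) : ℤ)),
    Finset.sum_range_succ, Finset.sum_range_succ,
    Finset.sum_congr rfl (g := fun x : ℕ => (a : ℤ) + x)
      (fun x hx => by simp [Finset.mem_range.1 hx])]
  have := hsum m
  simp
  linarith

/-- In the tree `T[a, a+k-2; a+k, a+k+1]`, if its order `2 * q + 1` is odd, vertices at distances
`j` and `j'` from the center on arms of lengths `L < L'` have distinct transmissions. -/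
theorem mul_ne_mul_of_length_lt {a k q L L' j j' : ℤ} (ha : 1 ≤ a) (hk : 2 ≤ k)
    (hq : 4 * q + 2 = (k + 1) * (2 * a + k) + 6) (hL : a ≤ L) (hLL' : L < L')
    (hL' : L' ≤ a + k + 1) (hj : 1 ≤ j) (hjL : j ≤ L) (hj' : 1 ≤ j') :
    j * (2 * q - 2 * L + j) ≠ j' * (2 * q - 2 * L' + j') := by
  intro h
  have hc : 0 ≤ q - L' := by nlinarith
  have hjj : j < j' := by
    by_contra! hle
    nlinarith [mul_le_mul hle hle (by omega) (by omega), mul_le_mul_of_nonneg_right hle hc]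
  obtain ⟨e, rfl⟩ : ∃ e, j' = j + e := ⟨j' - j, by ring⟩
  have he : Even e := by
    have : Even (e ^ 2) := ⟨j * (L' - L) - j * e - (q - L') * e, by linarith⟩
    exact (Int.even_pow.1 this).1
  obtain ⟨g, rfl⟩ := he
  have hg : 1 ≤ g := by omega
  have key : j * (L' - L - 2 * g) = 2 * g * (g + (q - L')) := by linarith
  have hpos : 0 < L' - L - 2 * g := by
    by_contra! hle
    nlinarith [mul_nonneg (show (0 : ℤ) ≤ g by omega) hc]
  have h₁ : j * (L' - L - 2 * g) ≤ L * (L' - L - 2) := by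
    nlinarith
  have h₂ : 2 * (1 + (q - L')) ≤ 2 * g * (g + (q - L')) := by nlinarith
  have h₃ : L * (L' - L - 2) ≤ L * (a + k - 1 - L) := by nlinarith
  nlinarith [sq_nonneg (2 * (L - a) - (k - 2)), mul_nonneg (sub_nonneg.2 ha) (sub_nonneg.2 hL)]

end Starlike

/-- The broken unit arithmetic starlike tree `T[a, a+k-2; a+k, a+k+1]`, whose `k+1` arm
lengths are `a, a+1, …, a+k-2, a+k, a+k+1`, is transmission irregular whenever
`k ≡ 3 (mod 4)` or `k + 2a ≡ 0 (mod 4)`. -/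
theorem stmt_11 (a k : ℕ) (ha : 1 ≤ a) (hk : 2 ≤ k)
    (hcong : k % 4 = 3 ∨ (k + 2 * a) % 4 = 0) :
    TransmissionIrregular (starlike (k + 1)
      (fun i => if i.val < k - 1 then a + i.val else a + i.val + 1)) := by
  set arm : Fin (k + 1) → ℕ :=
    fun i => if i.val < k - 1 then a + i.val else a + i.val + 1 with harm
  have hn := Starlike.two_mul_one_add_sum_broken_arms a k (by omega)
  obtain ⟨q, hq⟩ : ∃ q : ℤ, 4 * q + 2 = (k + 1) * (2 * a + k) + 6 := by
    have : (4 : ℤ) ∣ (k + 1) * (2 * a + k) := by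
      rcases hcong with h | h
      · exact Dvd.dvd.mul_right (by omega) _
      · exact Dvd.dvd.mul_left (by omega) _
    obtain ⟨c, hc⟩ := this
    exact ⟨c + 1, by rw [hc]; ring⟩
  have hsum : 1 + ∑ l, (arm l : ℤ) = 2 * q + 1 := by
    simp only [harm]
    linarith
  have hlow : ∀ i, a ≤ arm i := fun i => by simp only [harm]; split_ifs <;> omega
  have hhigh : ∀ i, arm i ≤ a + k + 1 := fun i => by
    have := i.2
    simp only [harm]
    split_ifs <;> omega
  have hinj : Function.Injective arm := fun i i' h => by
    simp only [harm] at h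
    ext
    split_ifs at h <;> omega
  have htr : ∀ i (j : Fin (arm i)),
      (transmission (starlike (k + 1) arm) (some ⟨i, j⟩) : ℤ) =
        transmission (starlike (k + 1) arm) none +
          ((j : ℤ) + 1) * (2 * q - 2 * arm i + ((j : ℤ) + 1)) := by
    intro i j
    rw [Starlike.transmission_some, hsum]
    ring
  have hpos : ∀ i, (arm i : ℤ) ≤ q := fun i => by
    have := hhigh i
    zify at this ha hk
    nlinarith
  have hcenter : ∀ i (j : Fin (arm i)), transmission (starlike (k + 1) arm) none ≠
      transmission (starlike (k + 1) arm) (some ⟨i, j⟩) := by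
    intro i j h
    have h' := htr i j
    rw [← h] at h'
    have := hpos i
    have : 0 < ((j : ℤ) + 1) * (2 * q - 2 * arm i + ((j : ℤ) + 1)) :=
      mul_pos (by omega) (by omega)
    omega
  have hlt : ∀ i i' (j : Fin (arm i)) (j' : Fin (arm i')), arm i < arm i' →
      transmission (starlike (k + 1) arm) (some ⟨i, j⟩) ≠
        transmission (starlike (k + 1) arm) (some ⟨i', j'⟩) := by
    intro i i' j j' hii h
    have h' : (transmission (starlike (k + 1) arm) (some ⟨i, j⟩) : ℤ) =
      transmission (starlike (k + 1) arm) (some ⟨i', j'⟩) := congrArg _ h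
    rw [htr, htr] at h'
    have h₁ := hlow i
    have h₂ := hhigh i'
    have h₃ := j.2
    exact Starlike.mul_ne_mul_of_length_lt (a := a) (k := k) (by omega) (by omega) hq
      (by omega) (by omega : (arm i : ℤ) < arm i') (by omega) (by omega) (by omega) (by omega)
      (add_left_cancel h')
  rintro (_ | ⟨i, j⟩) (_ | ⟨i', j'⟩) h
  · rfl
  · exact absurd h (hcenter i' j')
  · exact absurd h.symm (hcenter i j)
  · rcases lt_trichotomy (arm i) (arm i') with hii | hii | hii
    · exact absurd h (hlt i i' j j' hii)
    · obtain rfl := hinj hii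
      have h' : (transmission (starlike (k + 1) arm) (some ⟨i, j⟩) : ℤ) =
        transmission (starlike (k + 1) arm) (some ⟨i, j'⟩) := congrArg _ h
      rw [htr, htr] at h'
      have h₁ : ((j : ℤ) - j') * (2 * (q - arm i) + (j + 1) + (j' + 1)) = 0 := by linarith
      have := hpos i
      rcases mul_eq_zero.1 h₁ with h₂ | h₂
      · obtain rfl : j = j' := Fin.ext (by omega)
        rfl
      · omega
    · exact absurd h.symm (hlt i' i j' j hii)
end

section
/- Let a and k be positive integers and set h = (k-1)(2a+k) + 2a - 1. For p in {1, ..., a+k} define D_p = { p*h + p(p-1) + 2*p*i : i in {1, ..., k+1} } if p <= a, and D_p = { p*h + p(p-1) + 2*p*i : i in {1, ..., (k+1)-(p-a)} } if a < p <= a+k. Then the sets D_1, ..., D_{a+k} are pairwise disjoint. -/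
/-- The set `D_p` with `h = (k-1)(2a+k) + 2a - 1`:
`D_p = {p·h + p(p-1) + 2·p·i : i ∈ [k+1]}` for `p ∈ [a]`, and
`D_p = {p·h + p(p-1) + 2·p·i : i ∈ [(k+1)-(p-a)]}` for `a < p ≤ a+k`. -/
def Dset (a k : ℕ) (p : ℕ) : Set ℤ :=
  {x : ℤ | ∃ i : ℕ, 1 ≤ i ∧ i ≤ (if p ≤ a then k + 1 else (k + 1) - (p - a)) ∧
    x = (p : ℤ) * (((k : ℤ) - 1) * (2 * (a : ℤ) + (k : ℤ)) + 2 * (a : ℤ) - 1)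
        + (p : ℤ) * ((p : ℤ) - 1) + 2 * (p : ℤ) * (i : ℤ)}

/-- Two factorizations of one number with first factors `p < q` differ by enough that the smaller
cofactor `v` is bounded in terms of `p` and the gap `(q + u) - (p + v)`. -/
lemma cofactor_le_mul_gap {p q u v : ℤ} (hp : 0 < p) (hpq : p < q) (hv : 0 < v)
    (h : p * u = q * v) : v ≤ p * (q - p + u - v - 1) := by
  obtain ⟨P, Q, hPQ, hP, hQ⟩ := Int.exists_gcd_one (m := p) (n := q)
    (Int.gcd_pos_of_ne_zero_left _ hp.ne')
  have hg : (0 : ℤ) < (p.gcd q : ℤ) := by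
    exact_mod_cast Int.gcd_pos_of_ne_zero_left _ hp.ne'
  generalize (p.gcd q : ℤ) = g at hP hQ hg
  subst hP hQ
  have hP0 : 0 < P := pos_of_mul_pos_left hp hg.le
  have hlt : P < Q := lt_of_mul_lt_mul_right hpq hg.le
  have hred : P * u = Q * v := mul_right_cancel₀ hg.ne' (by linarith)
  obtain ⟨t, rfl⟩ : P ∣ v :=
    (Int.isCoprime_iff_gcd_eq_one.mpr hPQ).dvd_of_dvd_mul_left ⟨u, hred.symm⟩
  have hu : u = Q * t := mul_left_cancel₀ hP0.ne' (by linarith)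
  subst hu
  have ht : 0 < t := pos_of_mul_pos_right hv hP0.le
  have hgap : t + g ≤ Q * g - P * g + Q * t - P * t := by
    nlinarith [mul_nonneg (sub_nonneg.mpr (Int.add_one_le_iff.mpr hlt)) (add_pos ht hg).le]
  calc P * t ≤ P * g * t := by nlinarith [mul_pos hP0 ht]
    _ ≤ P * g * (Q * g - P * g + Q * t - P * t - 1) :=
      mul_le_mul_of_nonneg_left (by linarith) hp.le

lemma Dset_disjoint_of_lt {a k p q : ℕ} (ha : 1 ≤ a) (hk : 1 ≤ k) (hp : 1 ≤ p)
    (hpq : p < q) : Disjoint (Dset a k p) (Dset a k q) := by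
  rw [Set.disjoint_left]
  rintro x ⟨i, hi, hi', hx⟩ ⟨j, hj, -, hx'⟩
  zify at ha hk hp hpq hi hj
  have hak : (k : ℤ) ≤ a * k := by nlinarith
  have hkk : (k : ℤ) ≤ k * k := by nlinarith
  have hv := cofactor_le_mul_gap (p := (p : ℤ)) (q := q)
    (u := p + 2 * (i - 1) + k * (2 * a + k - 1)) (v := q + 2 * (j - 1) + k * (2 * a + k - 1))
    (by linarith) hpq (by nlinarith) (by linarith)
  have hgap : (p : ℤ) * (q - p + (p + 2 * (i - 1) + k * (2 * a + k - 1))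
      - (q + 2 * (j - 1) + k * (2 * a + k - 1)) - 1) = p * (2 * (i - j) - 1) := by ring
  rw [hgap] at hv
  split_ifs at hi' with hpa
  · zify at hi' hpa
    have hle : (p : ℤ) * (2 * (i - j) - 1) ≤ p * (2 * k - 1) :=
      mul_le_mul_of_nonneg_left (by linarith) (by linarith)
    have hle' : (p : ℤ) * (2 * k - 1) ≤ a * (2 * k - 1) :=
      mul_le_mul_of_nonneg_right hpa (by linarith)
    nlinarith
  · obtain ⟨s, rfl⟩ : ∃ s, p = a + s := ⟨p - a, by omega⟩
    have hs : i + s ≤ k + 1 := by omega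
    zify at hs
    push_cast at hv hpq
    have hle : ((a : ℤ) + s) * (2 * (i - j) - 1) ≤ (a + s) * (2 * (k - s) - 1) :=
      mul_le_mul_of_nonneg_left (by linarith) (by positivity)
    have hsq : (k : ℤ) - s ≤ (k - s) * (k - s) := by nlinarith
    nlinarith [mul_nonneg (Int.natCast_nonneg a) (Int.natCast_nonneg s), sq_nonneg (s : ℤ)]

/-- For positive integers `a` and `k`, the sets `D_1, …, D_{a+k}` are pairwise
disjoint. -/
theorem stmt_12 (a k : ℕ) (ha : 1 ≤ a) (hk : 1 ≤ k) :
    ∀ p ∈ Set.Icc 1 (a + k), ∀ q ∈ Set.Icc 1 (a + k), p ≠ q →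
      Disjoint (Dset a k p) (Dset a k q) := by
  intro p hp q hq hne
  rcases hne.lt_or_gt with h | h
  · exact Dset_disjoint_of_lt ha hk hp.1 h
  · exact (Dset_disjoint_of_lt ha hk hq.1 h).symm
end

section
/- Let a >= 2 and k >= 2 be integers and let T* = BS*(a, a+1, ..., a+k) be the tree obtained as follows: take two disjoint copies of the starlike tree T(a, a+1, ..., a+k), add an edge joining their two central vertices (the vertices of degree k+1), and attach one additional pendant vertex to one of these two central vertices. Then T* is transmission irregular. -/
/-- The bi-starlike tree `BS*(a, a+1, …, a+k)`: two disjoint copies (indexed by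
`Bool`) of the starlike tree `T(a, a+1, …, a+k)`, with an edge joining their two
central vertices, and one additional pendant vertex (`none`) attached to the central
vertex of the copy indexed by `true`. -/
def bsStar (a k : ℕ) :
    SimpleGraph (Option (Bool × Option (Σ i : Fin (k + 1), Fin (a + i.val)))) :=
  SimpleGraph.fromRel (fun x y =>
    (∃ b u v, x = some (b, u) ∧ y = some (b, v) ∧
      (starlike (k + 1) (fun i => a + i.val)).Adj u v) ∨
    (x = some (true, none) ∧ y = some (false, none)) ∨
    (x = none ∧ y = some (true, none)))

namespace SimpleGraph

variable {V : Type*} {G : SimpleGraph V}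

/-- A function which vanishes at `x`, is 1-Lipschitz along edges, and can be decreased by moving
to a neighbour from any vertex other than `x`, is the distance to `x`. -/
theorem dist_eq_of_exists_adj {x : V} (d : V → ℕ) (hx : d x = 0)
    (hadj : ∀ u v, G.Adj u v → d u ≤ d v + 1)
    (hstep : ∀ u, u ≠ x → ∃ w, G.Adj u w ∧ d w + 1 = d u) (u : V) : G.dist u x = d u := by
  have hwalk : ∀ n u, d u = n → ∃ p : G.Walk u x, p.length = n := by
    intro n
    induction n with
    | zero =>
      intro u hu
      by_cases h : u = x
      · subst h
        exact ⟨.nil, rfl⟩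
      · obtain ⟨w, -, hw⟩ := hstep u h
        omega
    | succ n ih =>
      intro u hu
      have h : u ≠ x := by
        rintro rfl
        omega
      obtain ⟨w, huw, hw⟩ := hstep u h
      obtain ⟨p, hp⟩ := ih w (by omega)
      exact ⟨.cons huw p, by simp [hp]⟩
  have hle : ∀ {u v : V} (p : G.Walk u v), d u ≤ d v + p.length := by
    intro u v p
    induction p with
    | nil => simp
    | cons h p ih =>
      have := hadj _ _ h
      simp only [Walk.length_cons]
      omega
  obtain ⟨p, hp⟩ := hwalk _ u rfl
  obtain ⟨q, hq⟩ := p.reachable.exists_walk_length_eq_dist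
  have h₁ := dist_le p
  have h₂ := hle q
  omega

end SimpleGraph

namespace bsStar

variable {a k : ℕ}

/-- The vertices of `bsStar a k`. -/
abbrev Vertex (a k : ℕ) : Type := Option (Bool × Option (Σ i : Fin (k + 1), Fin (a + i.val)))

theorem adj_pendant : (bsStar a k).Adj none (some (true, none)) := by
  simp [bsStar]

theorem adj_centers {b c : Bool} (h : b ≠ c) :
    (bsStar a k).Adj (some (b, none)) (some (c, none)) := by
  cases b <;> cases c <;> simp_all [bsStar]

theorem adj_center_arm (b : Bool) (i : Fin (k + 1)) (j : Fin (a + i.val)) (hj : (j : ℕ) = 0) :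
    (bsStar a k).Adj (some (b, none)) (some (b, some ⟨i, j⟩)) := by
  rw [bsStar, SimpleGraph.fromRel_adj]
  refine ⟨by simp, .inl (.inl ⟨b, _, _, rfl, rfl, ?_⟩)⟩
  rw [starlike, SimpleGraph.fromRel_adj]
  exact ⟨by simp, .inl (.inl ⟨i, j, rfl, rfl, hj⟩)⟩

theorem adj_arm (b : Bool) (i : Fin (k + 1)) (j j' : Fin (a + i.val))
    (hj : (j' : ℕ) = (j : ℕ) + 1) :
    (bsStar a k).Adj (some (b, some ⟨i, j⟩)) (some (b, some ⟨i, j'⟩)) := by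
  have hne : j ≠ j' := by
    rintro rfl
    omega
  rw [bsStar, SimpleGraph.fromRel_adj]
  refine ⟨by simpa using hne, .inl (.inl ⟨b, _, _, rfl, rfl, ?_⟩)⟩
  rw [starlike, SimpleGraph.fromRel_adj]
  exact ⟨by simpa using hne, .inl (.inr ⟨i, j, j', rfl, rfl, hj⟩)⟩

/-- To prove a symmetric relation for all adjacent vertices of `bsStar a k`, it suffices to check
the four types of edges. -/
theorem adj_induction {P : Vertex a k → Vertex a k → Prop} (hsymm : ∀ u v, P u v → P v u)
    (hpendant : P none (some (true, none))) (hcenters : P (some (true, none)) (some (false, none)))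
    (hcenter_arm : ∀ b i (j : Fin (a + i.val)), (j : ℕ) = 0 →
      P (some (b, none)) (some (b, some ⟨i, j⟩)))
    (harm : ∀ b i (j j' : Fin (a + i.val)), (j' : ℕ) = (j : ℕ) + 1 →
      P (some (b, some ⟨i, j⟩)) (some (b, some ⟨i, j'⟩)))
    {u v : Vertex a k} (h : (bsStar a k).Adj u v) : P u v := by
  have hstar : ∀ b s t, (starlike (k + 1) (fun i => a + i.val)).Adj s t →
      P (some (b, s)) (some (b, t)) := by
    intro b s t hst
    rw [starlike, SimpleGraph.fromRel_adj] at hst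
    obtain ⟨-, (⟨i, j, rfl, rfl, hj⟩ | ⟨i, j, j', rfl, rfl, hj⟩) |
      (⟨i, j, rfl, rfl, hj⟩ | ⟨i, j, j', rfl, rfl, hj⟩)⟩ := hst
    · exact hcenter_arm b i j hj
    · exact harm b i j j' hj
    · exact hsymm _ _ (hcenter_arm b i j hj)
    · exact hsymm _ _ (harm b i j j' hj)
  rw [bsStar, SimpleGraph.fromRel_adj] at h
  obtain ⟨-, (⟨b, s, t, rfl, rfl, hst⟩ | ⟨rfl, rfl⟩ | ⟨rfl, rfl⟩) |
    (⟨b, s, t, rfl, rfl, hst⟩ | ⟨rfl, rfl⟩ | ⟨rfl, rfl⟩)⟩ := h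
  · exact hstar b s t hst
  · exact hcenters
  · exact hpendant
  · exact hsymm _ _ (hstar b s t hst)
  · exact hsymm _ _ hcenters
  · exact hsymm _ _ hpendant

/-- The copy of the starlike tree to which a vertex is attached. -/
def side : Vertex a k → Bool
  | none => true
  | some (b, _) => b

/-- The distance from a vertex to the center of its copy. -/
def depth : Vertex a k → ℕ
  | none => 1
  | some (_, none) => 0
  | some (_, some ⟨_, j⟩) => j.val + 1

/-- The number of edges shared by the paths joining two vertices to the centers of their copies. -/
def overlap : Vertex a k → Vertex a k → ℕ
  | none, none => 1
  | some (b, some ⟨i, j⟩), some (b', some ⟨i', j'⟩) =>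
    if b = b' ∧ i = i' then min j.val j'.val + 1 else 0
  | _, _ => 0

/-- The distance between the centers of two copies. -/
def sideDist (b c : Bool) : ℕ := if b = c then 0 else 1

theorem two_mul_overlap_le (u v : Vertex a k) : 2 * overlap u v ≤ depth u + depth v := by
  rcases u with _ | ⟨b, _ | ⟨i, j⟩⟩ <;> rcases v with _ | ⟨b', _ | ⟨i', j'⟩⟩ <;>
    simp only [overlap, depth] <;> try omega
  split_ifs <;> omega

theorem dist_eq (u x : Vertex a k) (ha : 0 < a) :
    (bsStar a k).dist u x = depth u + depth x + sideDist (side u) (side x) - 2 * overlap u x := by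
  refine SimpleGraph.dist_eq_of_exists_adj
    (fun u => depth u + depth x + sideDist (side u) (side x) - 2 * overlap u x) ?_ ?_ ?_ u
  · rcases x with _ | ⟨b, _ | ⟨i, j⟩⟩ <;> simp [overlap, depth, sideDist]
    omega
  · intro u v h
    refine (adj_induction (P := fun u v =>
      depth u + depth x + sideDist (side u) (side x) - 2 * overlap u x ≤
        depth v + depth x + sideDist (side v) (side x) - 2 * overlap v x + 1 ∧
      depth v + depth x + sideDist (side v) (side x) - 2 * overlap v x ≤
        depth u + depth x + sideDist (side u) (side x) - 2 * overlap u x + 1)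
      (fun _ _ h => h.symm) ?_ ?_ ?_ ?_ h).1
    · rcases x with _ | ⟨b, _ | ⟨i, j⟩⟩ <;> grind [overlap, depth, sideDist, side]
    · rcases x with _ | ⟨b, _ | ⟨i, j⟩⟩ <;> grind [overlap, depth, sideDist, side]
    · intro b i j hj
      rcases x with _ | ⟨b', _ | ⟨i', j'⟩⟩ <;> grind [overlap, depth, sideDist, side]
    · intro b i j j₁ hj
      rcases x with _ | ⟨b', _ | ⟨i', j'⟩⟩ <;> grind [overlap, depth, sideDist, side]
  · rintro (_ | ⟨b, _ | ⟨i, j⟩⟩) hne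
    · refine ⟨_, adj_pendant, ?_⟩
      rcases x with _ | ⟨b', _ | ⟨i', j'⟩⟩
      · exact absurd rfl hne
      all_goals grind [overlap, depth, sideDist, side]
    · by_cases hb : b = side x
      · subst hb
        rcases x with _ | ⟨b', _ | ⟨i', j'⟩⟩
        · exact ⟨_, adj_pendant.symm, by simp [overlap, depth, sideDist, side]⟩
        · exact absurd rfl hne
        · refine ⟨_, adj_center_arm b' i' ⟨0, by omega⟩ rfl, ?_⟩
          simp [overlap, depth, sideDist, side]
          omega
      · refine ⟨_, adj_centers hb, ?_⟩
        rcases x with _ | ⟨b', _ | ⟨i', j'⟩⟩ <;>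
          simp_all [overlap, depth, sideDist, side]
    · by_cases hup : ∃ j' : Fin (a + i.val), x = some (b, some ⟨i, j'⟩) ∧ j < j'
      · obtain ⟨j', rfl, hj⟩ := hup
        refine ⟨_, adj_arm b i j ⟨j + 1, by omega⟩ rfl, ?_⟩
        simp [overlap, depth, sideDist, side]
        omega
      · have hover : overlap (some (b, some ⟨i, j⟩)) x ≤ j.val := by
          rcases x with _ | ⟨b', _ | ⟨i', j'⟩⟩ <;> simp only [overlap] <;> try omega
          split_ifs with h
          · obtain ⟨rfl, rfl⟩ := h
            have h₁ : ¬ j < j' := fun h => hup ⟨j', rfl, h⟩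
            have h₂ : j ≠ j' := fun h => hne (by rw [h])
            omega
          · omega
        rcases Nat.eq_zero_or_pos j.val with hj | hj
        · refine ⟨_, (adj_center_arm b i j hj).symm, ?_⟩
          rcases x with _ | ⟨b', _ | ⟨i', j'⟩⟩ <;>
            grind [overlap, depth, sideDist, side]
        · refine ⟨_, (adj_arm b i ⟨j - 1, by omega⟩ j (by simp; omega)).symm, ?_⟩
          rcases x with _ | ⟨b', _ | ⟨i', j'⟩⟩ <;>
            grind [overlap, depth, sideDist, side]

/-- The total length of the arms of `T(a, a+1, …, a+k)`. -/
def armSum (a k : ℕ) : ℕ := ∑ i : Fin (k + 1), (a + i.val)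

theorem card_vertex : Fintype.card (Vertex a k) = 2 * armSum a k + 3 := by
  simp only [Vertex, Fintype.card_option, Fintype.card_prod, Fintype.card_bool,
    Fintype.card_sigma, Fintype.card_fin, armSum]
  ring

theorem sum_sideDist (b : Bool) :
    ∑ u : Vertex a k, sideDist b (side u) = armSum a k + 1 + if b then 0 else 1 := by
  simp only [Fintype.sum_option, Fintype.sum_prod_type, Fintype.sum_bool, Fintype.sum_sigma, side]
  cases b <;> simp [sideDist, armSum, Finset.sum_add_distrib] <;> ring

theorem two_mul_sum_min (L d : ℕ) (h : d < L) :
    2 * ∑ j : Fin L, (min d j.val + 1) + (d + 1) ^ 2 = (d + 1) * (2 * L + 1) := by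
  rw [Fin.sum_univ_eq_sum_range (fun j => min d j + 1)]
  obtain ⟨c, rfl⟩ := Nat.exists_eq_add_of_lt h
  induction c with
  | zero =>
    have hmin : ∑ j ∈ Finset.range (d + 0 + 1), (min d j + 1) =
        ∑ j ∈ Finset.range (d + 1), (j + 1) :=
      Finset.sum_congr rfl fun j hj => by
        rw [Finset.mem_range] at hj
        omega
    have hgauss := Finset.sum_range_id_mul_two (d + 1)
    rw [hmin, Finset.sum_add_distrib]
    simp only [Finset.sum_const, Finset.card_range, smul_eq_mul, Nat.add_sub_cancel] at hgauss ⊢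
    linarith
  | succ c ih =>
    have := ih (by omega)
    rw [← add_assoc, Finset.sum_range_succ, min_eq_left (by omega)]
    linarith

/-- The transmission of the center to which the pendant vertex is attached. -/
def centerTransmission (a k : ℕ) : ℕ := ∑ u : Vertex a k, depth u + (armSum a k + 1)

theorem transmission_add (v : Vertex a k) (ha : 0 < a) :
    transmission (bsStar a k) v + 2 * ∑ u, overlap v u =
      (2 * armSum a k + 3) * depth v + (centerTransmission a k + if side v then 0 else 1) := by
  have hcongr : ∀ u, (bsStar a k).dist v u + 2 * overlap v u =
      depth v + depth u + sideDist (side v) (side u) := fun u => by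
    have := two_mul_overlap_le v u
    rw [dist_eq v u ha]
    omega
  rw [transmission, Finset.mul_sum, ← Finset.sum_add_distrib,
    Finset.sum_congr rfl fun u _ => hcongr u, Finset.sum_add_distrib, Finset.sum_add_distrib,
    sum_sideDist, Finset.sum_const, Finset.card_univ, card_vertex, smul_eq_mul, centerTransmission]
  ring

theorem transmission_center (b : Bool) (ha : 0 < a) :
    transmission (bsStar a k) (some (b, none)) =
      centerTransmission a k + if b then 0 else 1 := by
  have := transmission_add (a := a) (k := k) (some (b, none)) ha
  simp only [overlap, depth, side, Finset.sum_const_zero] at this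
  cases b <;> simp only [Bool.false_eq_true, if_true, if_false] at this ⊢ <;> omega

theorem transmission_pendant (ha : 0 < a) :
    transmission (bsStar a k) none = centerTransmission a k + (2 * armSum a k + 1) := by
  have := transmission_add (a := a) (k := k) none ha
  simp only [overlap, depth, side, Fintype.sum_option, Finset.sum_const_zero, if_true] at this
  omega

theorem sum_overlap_arm (b : Bool) (i : Fin (k + 1)) (j : Fin (a + i.val)) :
    ∑ u, overlap (some (b, some ⟨i, j⟩)) u =
      ∑ j' : Fin (a + i.val), (min j.val j'.val + 1) := by
  simp only [Fintype.sum_option, Fintype.sum_prod_type, Fintype.sum_sigma, overlap]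
  rw [Fintype.sum_eq_single b, Fintype.sum_eq_single i]
  · simp
  · intro i' hi
    simp [hi.symm]
  · intro b' hb
    simp [hb.symm]

theorem transmission_arm (b : Bool) (i : Fin (k + 1)) (j : Fin (a + i.val)) (ha : 0 < a) {m : ℕ}
    (hm : m + (a + i.val) = armSum a k + 1) :
    transmission (bsStar a k) (some (b, some ⟨i, j⟩)) =
      centerTransmission a k + (j.val + 1) * (2 * m + (j.val + 1)) + if b then 0 else 1 := by
  have h₁ := transmission_add (some (b, some ⟨i, j⟩)) ha
  have h₂ := two_mul_sum_min (a + i.val) j j.isLt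
  rw [sum_overlap_arm] at h₁
  simp only [depth, side] at h₁
  have h₃ : (j.val + 1) * (m + (a + i.val)) = (j.val + 1) * (armSum a k + 1) := by rw [hm]
  cases b <;> simp only [Bool.false_eq_true, if_true, if_false] at h₁ ⊢ <;> nlinarith

theorem mul_add_le_armSum {i i' : ℕ} (h : i ≤ i') (hi' : i' ≤ k) :
    (i' - i) * (a + i) + (a + i') ≤ armSum a k := by
  rw [armSum, Fin.sum_univ_eq_sum_range (fun i => a + i)]
  calc (i' - i) * (a + i) + (a + i')
      ≤ ∑ l ∈ Finset.Ico i i', (a + l) + (a + i') := by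
        gcongr
        rw [← smul_eq_mul, ← Nat.card_Ico]
        refine Finset.card_nsmul_le_sum _ _ _ fun l hl => ?_
        rw [Finset.mem_Ico] at hl
        omega
    _ = ∑ l ∈ Finset.Ico i (i' + 1), (a + l) := (Finset.sum_Ico_succ_top h _).symm
    _ ≤ ∑ l ∈ Finset.range (k + 1), (a + l) :=
        Finset.sum_le_sum_of_subset fun l hl => by
          simp only [Finset.mem_Ico, Finset.mem_range] at hl ⊢
          omega

/-- Deeper vertices, on whichever arm, have transmissions larger by at least three. -/
theorem arm_gap {i i' m m' d d' : ℕ} (hi' : i' ≤ k)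
    (hm : m + (a + i) = armSum a k + 1) (hm' : m' + (a + i') = armSum a k + 1)
    (hd : d ≤ a + i) (hdd' : d < d') :
    d * (2 * m + d) + 3 ≤ d' * (2 * m' + d') := by
  have hmono : (d + 1) * (2 * m' + (d + 1)) ≤ d' * (2 * m' + d') := by
    gcongr <;> omega
  refine le_trans ?_ hmono
  rcases le_total i i' with h | h
  · have hsum := mul_add_le_armSum (a := a) h hi'
    obtain ⟨e, rfl⟩ := Nat.exists_eq_add_of_le h
    rw [Nat.add_sub_cancel_left] at hsum
    have hmm : m = m' + e := by omega
    have hed : e * d ≤ e * (a + i) := Nat.mul_le_mul_left e hd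
    have hm'e : e * d + 1 ≤ m' := by omega
    subst hmm
    nlinarith
  · have hsum := mul_add_le_armSum (a := a) le_rfl hi'
    obtain ⟨e, rfl⟩ := Nat.exists_eq_add_of_le h
    have hmm : m' = m + e := by omega
    have : 1 ≤ m' := by omega
    subst hmm
    nlinarith

theorem two_mul_add_le_armSum {i : ℕ} (ha : 2 ≤ a) (hk : 2 ≤ k) (hi : i ≤ k) :
    2 * (a + i) ≤ armSum a k + 1 := by
  have h₁ := mul_add_le_armSum (a := a) (Nat.zero_le k) le_rfl
  simp only [Nat.sub_zero, add_zero] at h₁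
  nlinarith

theorem arm_ne_pendant {i m d : ℕ} (ha : 2 ≤ a) (hk : 2 ≤ k) (hi : i ≤ k)
    (hm : m + (a + i) = armSum a k + 1) (hd : 0 < d) :
    d * (2 * m + d) < 2 * armSum a k ∨ 2 * armSum a k + 1 < d * (2 * m + d) := by
  have hsum := two_mul_add_le_armSum ha hk hi
  rcases Nat.eq_or_lt_of_le hd with rfl | h
  · left
    omega
  · right
    have : 2 * (2 * m + 2) ≤ d * (2 * m + d) := by gcongr <;> omega
    omega

theorem exists_add_eq_armSum (i : Fin (k + 1)) : ∃ m, m + (a + i.val) = armSum a k + 1 :=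
  ⟨armSum a k + 1 - (a + i.val), by
    have := mul_add_le_armSum (a := a) le_rfl (Nat.le_of_lt_succ i.isLt)
    omega⟩

theorem transmission_arm_ne_center (b c : Bool) (i : Fin (k + 1)) (j : Fin (a + i.val))
    (ha : 0 < a) :
    transmission (bsStar a k) (some (b, some ⟨i, j⟩)) ≠
      transmission (bsStar a k) (some (c, none)) := by
  obtain ⟨m, hm⟩ := exists_add_eq_armSum (a := a) i
  have hsum := mul_add_le_armSum (a := a) le_rfl (Nat.le_of_lt_succ i.isLt)
  have hlarge : 1 * (2 * 1 + 1) ≤ (j.val + 1) * (2 * m + (j.val + 1)) := by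
    gcongr <;> omega
  rw [transmission_arm b i j ha hm, transmission_center c ha]
  split_ifs <;> omega

theorem transmission_arm_ne_pendant (b : Bool) (i : Fin (k + 1)) (j : Fin (a + i.val))
    (ha : 2 ≤ a) (hk : 2 ≤ k) :
    transmission (bsStar a k) (some (b, some ⟨i, j⟩)) ≠ transmission (bsStar a k) none := by
  obtain ⟨m, hm⟩ := exists_add_eq_armSum (a := a) i
  have := arm_ne_pendant ha hk (Nat.le_of_lt_succ i.isLt) hm j.val.succ_pos
  rw [Nat.succ_eq_add_one] at this
  rw [transmission_arm b i j (by omega) hm, transmission_pendant (by omega)]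
  split_ifs <;> omega

theorem transmission_center_ne_pendant (b : Bool) (ha : 0 < a) :
    transmission (bsStar a k) (some (b, none)) ≠ transmission (bsStar a k) none := by
  have := mul_add_le_armSum (a := a) le_rfl (Nat.zero_le k)
  rw [transmission_center b ha, transmission_pendant ha]
  split_ifs <;> omega

theorem eq_of_transmission_arm_eq {b b' : Bool} {i i' : Fin (k + 1)} {j : Fin (a + i.val)}
    {j' : Fin (a + i'.val)} (ha : 0 < a)
    (h : transmission (bsStar a k) (some (b, some ⟨i, j⟩)) =
      transmission (bsStar a k) (some (b', some ⟨i', j'⟩))) :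
    (some (b, some ⟨i, j⟩) : Vertex a k) = some (b', some ⟨i', j'⟩) := by
  obtain ⟨m, hm⟩ := exists_add_eq_armSum (a := a) i
  obtain ⟨m', hm'⟩ := exists_add_eq_armSum (a := a) i'
  rw [transmission_arm b i j ha hm, transmission_arm b' i' j' ha hm'] at h
  rcases lt_trichotomy j.val j'.val with hj | hj | hj
  · have := arm_gap (Nat.le_of_lt_succ i'.isLt) hm hm' j.isLt (Nat.succ_lt_succ hj)
    simp only [Nat.succ_eq_add_one] at this
    split_ifs at h <;> omega
  · have hmm : m = m' := by
      rw [hj] at h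
      rcases lt_trichotomy m m' with hlt | heq | hlt
      · split_ifs at h <;> nlinarith
      · exact heq
      · split_ifs at h <;> nlinarith
    subst hmm
    obtain rfl : i = i' := Fin.ext (by omega)
    obtain rfl : j = j' := Fin.ext hj
    cases b <;> cases b' <;> simp_all
  · have := arm_gap (Nat.le_of_lt_succ i.isLt) hm' hm j'.isLt (Nat.succ_lt_succ hj)
    simp only [Nat.succ_eq_add_one] at this
    split_ifs at h <;> omega

end bsStar

/-- For `a ≥ 2` and `k ≥ 2`, the bi-starlike tree `BS*(a, a+1, …, a+k)` is
transmission irregular. -/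
theorem stmt_15 (a k : ℕ) (ha : 2 ≤ a) (hk : 2 ≤ k) :
    TransmissionIrregular (bsStar a k) := by
  have ha₀ : 0 < a := by omega
  rintro (_ | ⟨b, _ | ⟨i, j⟩⟩) (_ | ⟨b', _ | ⟨i', j'⟩⟩) h
  · rfl
  · exact absurd h.symm (bsStar.transmission_center_ne_pendant b' ha₀)
  · exact absurd h.symm (bsStar.transmission_arm_ne_pendant b' i' j' ha hk)
  · exact absurd h (bsStar.transmission_center_ne_pendant b ha₀)
  · rw [bsStar.transmission_center b ha₀, bsStar.transmission_center b' ha₀] at h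
    cases b <;> cases b' <;> simp_all
  · exact absurd h.symm (bsStar.transmission_arm_ne_center b' b i' j' ha₀)
  · exact absurd h (bsStar.transmission_arm_ne_pendant b i j ha hk)
  · exact absurd h (bsStar.transmission_arm_ne_center b b' i j ha₀)
  · exact bsStar.eq_of_transmission_arm_eq ha₀ h
end

section
/- Let k >= 3 be an integer and let G = C_3(1; 1, k; 2, k) be the unicyclic graph obtained from a triangle with vertices w, u, v by attaching at w one pendant path of length 1, at u two pendant paths of lengths 1 and k, and at v two pendant paths of lengths 2 and k. Let A_0 = { k+9, 2k+11, 2k+14, 3k+14, 4k+16 }, A = A_0 union (A_0 + 1), and B = { i^2 : i an integer with 3 <= i <= k+3 }. If A and B are disjoint, then G is transmission irregular. -/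
/-- The graph obtained from a triangle (vertices `Sum.inl 0`, `Sum.inl 1`, `Sum.inl 2`)
by attaching `t` pairwise disjoint pendant paths: the `j`-th path has length `L j` and
is attached at the triangle vertex `c j`; `Sum.inr ⟨j, m⟩` is the vertex at distance
`m + 1` from the triangle along the `j`-th path. -/
def triWithPaths (t : ℕ) (L : Fin t → ℕ) (c : Fin t → Fin 3) :
    SimpleGraph (Fin 3 ⊕ Σ j : Fin t, Fin (L j)) :=
  SimpleGraph.fromRel (fun x y =>
    (∃ i i' : Fin 3, x = Sum.inl i ∧ y = Sum.inl i' ∧ i ≠ i') ∨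
    (∃ j : Fin t, ∃ m : Fin (L j), x = Sum.inl (c j) ∧ y = Sum.inr ⟨j, m⟩ ∧
      (m : ℕ) = 0) ∨
    (∃ j : Fin t, ∃ m m' : Fin (L j), x = Sum.inr ⟨j, m⟩ ∧ y = Sum.inr ⟨j, m'⟩ ∧
      (m' : ℕ) = (m : ℕ) + 1))

/-- A function that behaves like the distance from `x` along the edges of `G` is that distance. -/
theorem SimpleGraph.dist_eq_of_potential {V : Type*} {G : SimpleGraph V} {x : V} (f : V → ℕ)
    (hx : f x = 0) (hle : ∀ y z, G.Adj y z → f z ≤ f y + 1)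
    (hdesc : ∀ y, y ≠ x → ∃ z, G.Adj z y ∧ f y = f z + 1) (y : V) : G.dist x y = f y := by
  have lower : ∀ {a b : V} (p : G.Walk a b), f b ≤ f a + p.length := by
    intro a b p
    induction p with
    | nil => simp
    | cons h p ih =>
      have := hle _ _ h
      simp only [SimpleGraph.Walk.length_cons]
      omega
  have upper : ∀ n y, f y = n → ∃ p : G.Walk x y, p.length = n := by
    intro n
    induction n with
    | zero =>
      intro y hy
      by_cases h : y = x
      · subst h
        exact ⟨.nil, rfl⟩
      · obtain ⟨z, -, hz⟩ := hdesc y h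
        omega
    | succ n ih =>
      intro y hy
      have h : y ≠ x := by
        rintro rfl
        omega
      obtain ⟨z, hzy, hz⟩ := hdesc y h
      obtain ⟨p, hp⟩ := ih z (by omega)
      exact ⟨p.concat hzy, by simp [hp]⟩
  obtain ⟨p, hp⟩ := upper _ y rfl
  obtain ⟨q, hq⟩ := p.reachable.exists_walk_length_eq_dist
  have h₁ := SimpleGraph.dist_le p
  have h₂ := lower q
  omega

theorem sum_fin_succ_add_mul_two (n a : ℕ) :
    (∑ m : Fin n, ((m : ℕ) + 1 + a)) * 2 = n * (n + 1 + 2 * a) := by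
  rw [Fin.sum_univ_eq_sum_range (fun m => m + 1 + a)]
  induction n with
  | zero => simp
  | succ n ih =>
    rw [Finset.sum_range_succ, add_mul, ih]
    ring

section TriWithPaths

variable {t : ℕ} {L : Fin t → ℕ} {c : Fin t → Fin 3}

theorem triWithPaths_adj_inl {i i' : Fin 3} :
    (triWithPaths t L c).Adj (.inl i) (.inl i') ↔ i ≠ i' := by
  simp [triWithPaths]
  grind

theorem triWithPaths_adj_inl_inr {i : Fin 3} {j : Fin t} {m : Fin (L j)} :
    (triWithPaths t L c).Adj (.inl i) (.inr ⟨j, m⟩) ↔ i = c j ∧ (m : ℕ) = 0 := by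
  simp only [triWithPaths, SimpleGraph.fromRel_adj]
  constructor
  · rintro ⟨-, (⟨_, _, _, h, _⟩ | ⟨_, _, h₁, h₂, h₃⟩ | ⟨_, _, _, h, _⟩) |
      (⟨_, _, h, _⟩ | ⟨_, _, h, _⟩ | ⟨_, _, _, _, h, _⟩)⟩
    all_goals first | cases h | (cases h₁; cases h₂; exact ⟨rfl, h₃⟩)
  · rintro ⟨rfl, h⟩
    exact ⟨by simp, .inl (.inr (.inl ⟨j, m, rfl, rfl, h⟩))⟩

theorem triWithPaths_adj_inr {j j' : Fin t} {m : Fin (L j)} {m' : Fin (L j')} :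
    (triWithPaths t L c).Adj (.inr ⟨j, m⟩) (.inr ⟨j', m'⟩) ↔
      j = j' ∧ ((m' : ℕ) = m + 1 ∨ (m : ℕ) = m' + 1) := by
  simp only [triWithPaths, SimpleGraph.fromRel_adj]
  constructor
  · rintro ⟨-, (⟨_, _, h, _⟩ | ⟨_, _, h, _⟩ | ⟨_, _, _, h₁, h₂, h₃⟩) |
      (⟨_, _, h, _⟩ | ⟨_, _, h, _⟩ | ⟨_, _, _, h₁, h₂, h₃⟩)⟩
    all_goals first | cases h | (cases h₁; cases h₂; simp [h₃])
  · rintro ⟨rfl, h⟩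
    refine ⟨fun e => ?_, h.imp (fun h => .inr (.inr ⟨j, m, m', rfl, rfl, h⟩))
      (fun h => .inr (.inr ⟨j, m', m, rfl, rfl, h⟩))⟩
    cases e
    omega

/-- The distance in `triWithPaths`, by cases on the positions of the two vertices. -/
def triWithPathsDist (c : Fin t → Fin 3) :
    (Fin 3 ⊕ Σ j : Fin t, Fin (L j)) → (Fin 3 ⊕ Σ j : Fin t, Fin (L j)) → ℕ
  | .inl i, .inl i' => if i = i' then 0 else 1
  | .inl i, .inr ⟨j, m⟩ => m + 1 + if i = c j then 0 else 1
  | .inr ⟨j, m⟩, .inl i => m + 1 + if c j = i then 0 else 1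
  | .inr ⟨j, m⟩, .inr ⟨j', m'⟩ =>
    if j = j' then (m - m' : ℕ) + (m' - m : ℕ)
    else (m + 1) + (m' + 1) + if c j = c j' then 0 else 1

theorem triWithPaths_dist (x y : Fin 3 ⊕ Σ j : Fin t, Fin (L j)) :
    (triWithPaths t L c).dist x y = triWithPathsDist c x y := by
  refine SimpleGraph.dist_eq_of_potential (triWithPathsDist c x) ?_ ?_ ?_ y
  · rcases x with i | ⟨j, m⟩ <;> simp [triWithPathsDist]
  · rintro (i | ⟨j, m⟩) (i' | ⟨j', m'⟩) h
    · rcases x with a | ⟨b, n⟩ <;> simp only [triWithPathsDist] <;> split_ifs <;> omega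
    · obtain ⟨rfl, h⟩ := triWithPaths_adj_inl_inr.1 h
      rcases x with a | ⟨b, n⟩
      · simp only [triWithPathsDist]
        omega
      · simp only [triWithPathsDist]
        split_ifs <;> simp_all
        omega
    · obtain ⟨rfl, h⟩ := triWithPaths_adj_inl_inr.1 h.symm
      rcases x with a | ⟨b, n⟩
      · simp only [triWithPathsDist]
        omega
      · simp only [triWithPathsDist]
        split_ifs <;> simp_all
    · obtain ⟨rfl, h⟩ := triWithPaths_adj_inr.1 h
      rcases x with a | ⟨b, n⟩ <;> simp only [triWithPathsDist] <;> split_ifs <;> omega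
  · rintro (i | ⟨j, m, hm⟩) hne
    · rcases x with a | ⟨b, n, hn⟩
      · have hai : a ≠ i := fun e => hne (e ▸ rfl)
        exact ⟨.inl a, triWithPaths_adj_inl.2 hai, by simp [triWithPathsDist, hai]⟩
      · by_cases hb : c b = i
        · exact ⟨.inr ⟨b, ⟨0, by omega⟩⟩, (triWithPaths_adj_inl_inr.2 ⟨hb.symm, rfl⟩).symm,
            by simp [triWithPathsDist, hb]⟩
        · exact ⟨.inl (c b), triWithPaths_adj_inl.2 hb, by simp [triWithPathsDist, hb]⟩
    · have parent : (∀ n : Fin (L j), x = .inr ⟨j, n⟩ → (n : ℕ) < m) →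
          ∃ z, (triWithPaths t L c).Adj z (.inr ⟨j, ⟨m, hm⟩⟩) ∧
            triWithPathsDist c x (.inr ⟨j, ⟨m, hm⟩⟩) = triWithPathsDist c x z + 1 := by
        intro hx
        rcases m with _ | m
        · refine ⟨.inl (c j), triWithPaths_adj_inl_inr.2 ⟨rfl, rfl⟩, ?_⟩
          rcases x with a | ⟨b, n⟩
          · simp only [triWithPathsDist]
            omega
          · have hb : b ≠ j := by
              rintro rfl
              exact absurd (hx n rfl) (by omega)
            simp only [triWithPathsDist, hb, if_false]
            omega
        · refine ⟨.inr ⟨j, ⟨m, by omega⟩⟩, triWithPaths_adj_inr.2 ⟨rfl, .inl rfl⟩, ?_⟩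
          rcases x with a | ⟨b, n⟩
          · simp only [triWithPathsDist]
            omega
          · by_cases hb : b = j
            · subst hb
              have := hx n rfl
              simp only [triWithPathsDist, if_true]
              omega
            · simp only [triWithPathsDist, hb, if_false]
              omega
      by_cases hx : ∃ n : Fin (L j), x = .inr ⟨j, n⟩ ∧ m ≤ n
      · obtain ⟨n, rfl, hmn⟩ := hx
        have hlt : m ≠ n := by
          rintro rfl
          exact hne rfl
        refine ⟨.inr ⟨j, ⟨m + 1, by omega⟩⟩, triWithPaths_adj_inr.2 ⟨rfl, .inr rfl⟩, ?_⟩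
        simp only [triWithPathsDist, if_true]
        omega
      · exact parent fun n hn => not_le.1 fun h => hx ⟨n, hn, h⟩

theorem transmission_triWithPaths_inl (i : Fin 3) :
    transmission (triWithPaths t L c) (.inl i) * 2 =
      4 + ∑ j, L j * (L j + 1 + 2 * if i = c j then 0 else 1) := by
  simp only [transmission, triWithPaths_dist, Fintype.sum_sum_type, Fintype.sum_sigma,
    triWithPathsDist, ← sum_fin_succ_add_mul_two, add_mul, Finset.sum_mul]
  congr 1
  fin_cases i <;> simp [Fin.sum_univ_three]

theorem sum_fin_dist_add {n m : ℕ} (hm : m < n) :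
    ∑ i : Fin n, ((m - i : ℕ) + (i - m : ℕ)) + n * (m + 1) =
      ∑ i : Fin n, ((i : ℕ) + 1) + (m + 1) * m := by
  rw [Fin.sum_univ_eq_sum_range (fun i => (m - i) + (i - m)),
    Fin.sum_univ_eq_sum_range (fun i => i + 1)]
  induction n, hm using Nat.le_induction with
  | base =>
    have h := Finset.sum_range_reflect (fun i => i) (m + 1)
    have h₁ : ∑ i ∈ Finset.range (m + 1), ((m - i) + (i - m)) =
        ∑ i ∈ Finset.range (m + 1), i := by
      rw [← h]
      refine Finset.sum_congr rfl fun i hi => ?_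
      have := Finset.mem_range.1 hi
      omega
    rw [h₁, Finset.sum_add_distrib]
    simp
    ring
  | succ n hn ih =>
    rw [Finset.sum_range_succ, Finset.sum_range_succ]
    have : (m - n) + (n - m) + (m + 1) = n + 1 := by omega
    linarith

theorem transmission_triWithPaths_inr (j : Fin t) (m : Fin (L j)) :
    transmission (triWithPaths t L c) (.inr ⟨j, m⟩) + 2 * L j * (m + 1) =
      transmission (triWithPaths t L c) (.inl (c j)) + (m + 1) * (3 + ∑ j, L j + m) := by
  have path : ∀ j' : Fin t,
      ∑ m' : Fin (L j'), triWithPathsDist c (.inr ⟨j, m⟩) (.inr ⟨j', m'⟩) +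
          (if j' = j then 2 * L j * (m + 1) else 0) =
        ∑ m' : Fin (L j'), triWithPathsDist c (.inl (c j)) (.inr ⟨j', m'⟩) + L j' * (m + 1) +
          (if j' = j then (m + 1) * (m : ℕ) else 0) := by
    intro j'
    by_cases h : j' = j
    · subst h
      have := sum_fin_dist_add m.2
      simp only [triWithPathsDist, if_true, add_zero]
      linarith
    · simp only [triWithPathsDist, if_neg h, if_neg (Ne.symm h), add_zero]
      have : ∀ m' : Fin (L j'),
          (m : ℕ) + 1 + (m' + 1) + (if c j = c j' then 0 else 1) =
            (m' + 1 + if c j = c j' then 0 else 1) + (m + 1) := fun m' => by ring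
      simp only [this]
      rw [Finset.sum_add_distrib]
      simp
  have total := Finset.sum_congr rfl fun j' (_ : j' ∈ Finset.univ) => path j'
  simp only [Finset.sum_add_distrib, Finset.sum_ite_eq', Finset.mem_univ, if_true,
    ← Finset.sum_mul] at total
  have tri : ∑ i : Fin 3, triWithPathsDist c (.inr ⟨j, m⟩) (.inl i) =
      ∑ i : Fin 3, triWithPathsDist (L := L) c (.inl (c j)) (.inl i) + 3 * (m + 1) := by
    simp only [triWithPathsDist, Finset.sum_add_distrib]
    simp
    ring
  simp only [transmission, triWithPaths_dist, Fintype.sum_sum_type, Fintype.sum_sigma, tri]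
  linarith

end TriWithPaths

/-- Let `k ≥ 3` and let `G = C₃(1; 1, k; 2, k)` be the unicyclic graph obtained from a
triangle `w u v` by attaching at `w` a pendant path of length `1`, at `u` pendant paths
of lengths `1` and `k`, and at `v` pendant paths of lengths `2` and `k`. With
`A₀ = {k+9, 2k+11, 2k+14, 3k+14, 4k+16}`, `A = A₀ ∪ (A₀ + 1)` and
`B = {i² : 3 ≤ i ≤ k+3}`, if `A ∩ B = ∅` then `G` is transmission irregular. -/
theorem stmt_16 (k : ℕ) (hk : 3 ≤ k)
    (hAB : (({k + 9, 2 * k + 11, 2 * k + 14, 3 * k + 14, 4 * k + 16} : Set ℕ) ∪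
          {x : ℕ | ∃ y ∈ ({k + 9, 2 * k + 11, 2 * k + 14, 3 * k + 14, 4 * k + 16} :
            Set ℕ), x = y + 1}) ∩
        {x : ℕ | ∃ i : ℕ, 3 ≤ i ∧ i ≤ k + 3 ∧ x = i ^ 2} = ∅) :
    TransmissionIrregular (triWithPaths 5 ![1, 1, k, 2, k] ![0, 1, 1, 2, 2]) := by
  set G := triWithPaths 5 ![1, 1, k, 2, k] ![0, 1, 1, 2, 2]
  have root : transmission G (.inl 0) = k ^ 2 + 2 * k + (k + 10) ∧
      transmission G (.inl 1) = k ^ 2 + 2 * k + 10 ∧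
      transmission G (.inl 2) = k ^ 2 + 2 * k + 9 := by
    refine ⟨?_, ?_, ?_⟩ <;> refine Nat.mul_right_cancel two_pos ?_ <;>
    · rw [transmission_triWithPaths_inl, Fin.sum_univ_five]
      simp
      ring
  obtain ⟨h₀, h₁, h₂⟩ := root
  have hsum : ∑ j, ![1, 1, k, 2, k] j = 2 * k + 4 := by
    simp [Fin.sum_univ_five]
    ring
  have path := transmission_triWithPaths_inr (L := ![1, 1, k, 2, k]) (c := ![0, 1, 1, 2, 2])
  rw [hsum] at path
  have cases_vertex : ∀ x, (x = .inl 0 ∧ transmission G x = k ^ 2 + 2 * k + (k + 10)) ∨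
      (x = .inl 1 ∧ transmission G x = k ^ 2 + 2 * k + 10) ∨
      (x = .inl 2 ∧ transmission G x = k ^ 2 + 2 * k + 9) ∨
      (x = .inr ⟨0, (0 : Fin 1)⟩ ∧ transmission G x = k ^ 2 + 2 * k + (3 * k + 15)) ∨
      (x = .inr ⟨1, (0 : Fin 1)⟩ ∧ transmission G x = k ^ 2 + 2 * k + (2 * k + 15)) ∨
      (∃ m : Fin k, x = .inr ⟨2, m⟩ ∧
        transmission G x = k ^ 2 + 2 * k + ((m + 4) ^ 2 + 1)) ∨
      (x = .inr ⟨3, (0 : Fin 2)⟩ ∧ transmission G x = k ^ 2 + 2 * k + (2 * k + 12)) ∨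
      (x = .inr ⟨3, (1 : Fin 2)⟩ ∧ transmission G x = k ^ 2 + 2 * k + (4 * k + 17)) ∨
      (∃ m : Fin k, x = .inr ⟨4, m⟩ ∧ transmission G x = k ^ 2 + 2 * k + (m + 4) ^ 2) := by
    have p₀ : transmission G (.inr ⟨0, (0 : Fin 1)⟩) + 2 * 1 * (0 + 1) =
      transmission G (.inl 0) + (0 + 1) * (3 + (2 * k + 4) + 0) := path 0 (0 : Fin 1)
    have p₁ : transmission G (.inr ⟨1, (0 : Fin 1)⟩) + 2 * 1 * (0 + 1) =
      transmission G (.inl 1) + (0 + 1) * (3 + (2 * k + 4) + 0) := path 1 (0 : Fin 1)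
    have p₂ (m : Fin k) : transmission G (.inr ⟨2, m⟩) + 2 * k * (m + 1) =
      transmission G (.inl 1) + (m + 1) * (3 + (2 * k + 4) + m) := path 2 m
    have p₃ : transmission G (.inr ⟨3, (0 : Fin 2)⟩) + 2 * 2 * (0 + 1) =
      transmission G (.inl 2) + (0 + 1) * (3 + (2 * k + 4) + 0) := path 3 (0 : Fin 2)
    have p₃' : transmission G (.inr ⟨3, (1 : Fin 2)⟩) + 2 * 2 * (1 + 1) =
      transmission G (.inl 2) + (1 + 1) * (3 + (2 * k + 4) + 1) := path 3 (1 : Fin 2)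
    have p₄ (m : Fin k) : transmission G (.inr ⟨4, m⟩) + 2 * k * (m + 1) =
      transmission G (.inl 2) + (m + 1) * (3 + (2 * k + 4) + m) := path 4 m
    have q₂ (m : Fin k) : transmission G (.inr ⟨2, m⟩) =
      k ^ 2 + 2 * k + ((m + 4) ^ 2 + 1) := by linarith [p₂ m]
    have q₄ (m : Fin k) : transmission G (.inr ⟨4, m⟩) =
      k ^ 2 + 2 * k + (m + 4) ^ 2 := by linarith [p₄ m]
    replace p₀ : transmission G (.inr ⟨0, (0 : Fin 1)⟩) = k ^ 2 + 2 * k + (3 * k + 15) := by omega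
    replace p₁ : transmission G (.inr ⟨1, (0 : Fin 1)⟩) = k ^ 2 + 2 * k + (2 * k + 15) := by omega
    replace p₃ : transmission G (.inr ⟨3, (0 : Fin 2)⟩) = k ^ 2 + 2 * k + (2 * k + 12) := by omega
    replace p₃' : transmission G (.inr ⟨3, (1 : Fin 2)⟩) = k ^ 2 + 2 * k + (4 * k + 17) := by omega
    rintro (i | ⟨j, m⟩)
    · fin_cases i
      · exact .inl ⟨rfl, h₀⟩
      · exact .inr (.inl ⟨rfl, h₁⟩)
      · exact .inr (.inr (.inl ⟨rfl, h₂⟩))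
    · fin_cases j
      · obtain rfl : m = (0 : Fin 1) := Subsingleton.elim (α := Fin 1) _ _
        exact .inr (.inr (.inr (.inl ⟨rfl, p₀⟩)))
      · obtain rfl : m = (0 : Fin 1) := Subsingleton.elim (α := Fin 1) _ _
        exact .inr (.inr (.inr (.inr (.inl ⟨rfl, p₁⟩))))
      · exact .inr (.inr (.inr (.inr (.inr (.inl ⟨m, rfl, q₂ m⟩)))))
      · change Fin 2 at m
        fin_cases m
        · exact .inr (.inr (.inr (.inr (.inr (.inr (.inl ⟨rfl, p₃⟩))))))
        · exact .inr (.inr (.inr (.inr (.inr (.inr (.inr (.inl ⟨rfl, p₃'⟩)))))))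
      · exact .inr (.inr (.inr (.inr (.inr (.inr (.inr (.inr ⟨m, rfl, q₄ m⟩)))))))
  have avoid (i : ℕ) (hi : 3 ≤ i) (hik : i ≤ k + 3) :
      (i ^ 2 ≠ k + 9 ∧ i ^ 2 ≠ 2 * k + 11 ∧ i ^ 2 ≠ 2 * k + 14 ∧ i ^ 2 ≠ 3 * k + 14 ∧
        i ^ 2 ≠ 4 * k + 16) ∧ i ^ 2 ≠ k + 10 ∧ i ^ 2 ≠ 2 * k + 12 ∧ i ^ 2 ≠ 2 * k + 15 ∧
        i ^ 2 ≠ 3 * k + 15 ∧ i ^ 2 ≠ 4 * k + 17 := by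
    have h := fun e => Set.eq_empty_iff_forall_notMem.1 hAB (i ^ 2) ⟨e, i, hi, hik, rfl⟩
    simp only [Set.mem_union, Set.mem_insert_iff, Set.mem_singleton_iff, Set.mem_ofPred_eq,
      exists_eq_or_imp, exists_eq_left, imp_false] at h
    omega
  have avoid' (m : Fin k) := avoid (m + 4) (by omega) (by omega)
  have sq_ge (m : Fin k) : 16 ≤ ((m : ℕ) + 4) ^ 2 := Nat.pow_le_pow_left (by omega : 4 ≤ _) 2
  have sq_inj {m m' : Fin k} (h : ((m : ℕ) + 4) ^ 2 = (m' + 4) ^ 2) : m = m' := by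
    have := Nat.pow_left_injective two_ne_zero h
    exact Fin.ext (by omega)
  have sq_gap (m m' : Fin k) : ((m : ℕ) + 4) ^ 2 + 1 ≠ (m' + 4) ^ 2 := by
    intro h
    rcases le_or_gt (m' : ℕ) m with hle | hlt
    · nlinarith
    · nlinarith
  intro x y hxy
  rcases cases_vertex x with ⟨rfl, hx⟩ | ⟨rfl, hx⟩ | ⟨rfl, hx⟩ | ⟨rfl, hx⟩ | ⟨rfl, hx⟩ |
      ⟨m, rfl, hx⟩ | ⟨rfl, hx⟩ | ⟨rfl, hx⟩ | ⟨m, rfl, hx⟩ <;>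
    rcases cases_vertex y with ⟨rfl, hy⟩ | ⟨rfl, hy⟩ | ⟨rfl, hy⟩ | ⟨rfl, hy⟩ | ⟨rfl, hy⟩ |
      ⟨m', rfl, hy⟩ | ⟨rfl, hy⟩ | ⟨rfl, hy⟩ | ⟨m', rfl, hy⟩ <;>
    replace hxy := hx.symm.trans (hxy.trans hy) <;>
    first
    | rfl
    | (exfalso; omega)
    | (exfalso; have := avoid' m; have := sq_ge m; omega)
    | (exfalso; have := avoid' m'; have := sq_ge m'; omega)
    | (exfalso; have := sq_gap m m'; have := sq_gap m' m; omega)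
    | (obtain rfl := sq_inj (m := m) (m' := m') (by omega); rfl)
end
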